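/- Theorem (A₂^{(1)} Andrews–Gordon identities, modulus K = 3k+2). Let k ≥ 1 be an integer and set K := 3k+2. For integers 0 ≤ a ≤ k and 0 ≤ b < k, as formal power series in q: χ̃_{a,b}^K(q) = Σ_{λ_1,…,λ_k ≥ 0; μ_1,…,μ_{k−1} ≥ 0} q^{λ_k² + Σ_{i=a+1}^k λ_i + Σ_{i=b+1}^{k−1} μ_i}/(q;q)_{λ_1} · ∏_{i=1}^{k−1} q^{λ_i²−λ_iμ_i+μ_i²} [λ_i, λ_{i+1}]_q [λ_i−λ_{i+1}+μ_{i+1}+δ_{b,i}, μ_i]_q − Σ_{λ_1,…,λ_k ≥ 0; μ_1,…,μ_{k−1} ≥ 0} q^{1+λ_k²+Σ_{i=a}^k λ_i + Σ_{i=b}^{k−1} μ_i}/(q;q)_{λ_1} · ∏_{i=1}^{k−1} q^{λ_i²−λ_iμ_i+μ_i²} [λ_i, λ_{i+1}]_q [λ_i−λ_{i+1}+μ_{i+1}+δ_{b−1,i}, μ_i]_q, where λ_{k+1} := 0, μ_k := 2λ_k, δ is the Kronecker delta, and the convention q^{λ_0} = q^{μ_0} := 0 is used (so the second multisum vanishes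 when a = 0 or b = 0). Moreover χ̃_{k,k}^K(q) = Σ_{λ_1,…,λ_k ≥ 0; μ_1,…,μ_{k−1} ≥ 0} (q^{λ_k²}/(q;q)_{λ_1}) ∏_{i=1}^{k−1} q^{λ_i²−λ_iμ_i+μ_i²} [λ_i, λ_{i+1}]_q [λ_i−λ_{i+1}+μ_{i+1}, μ_i]_q with the same conventions. -/

import Mathlib

noncomputable section

namespace Stmt2

/-- `(a; q)_n`, the finite q-Pochhammer symbol. -/
def qPoch (a q : ℂ) (n : ℕ) : ℂ := ∏ j ∈ Finset.range n, (1 - a * q ^ j)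

/-- `(a; q)_∞`. -/
def qPochInf (a q : ℂ) : ℂ := ∏' j : ℕ, (1 - a * q ^ j)

/-- The modified theta function `θ(z; q) = (z;q)_∞ (q/z;q)_∞`. -/
def theta (z q : ℂ) : ℂ := qPochInf z q * qPochInf (q / z) q

/-- The q-binomial coefficient, vanishing unless `0 ≤ m ≤ n`. -/
def qBinom (q : ℂ) (n m : ℤ) : ℂ :=
  if 0 ≤ m ∧ m ≤ n then
    qPoch q q n.toNat / (qPoch q q m.toNat * qPoch q q (n - m).toNat)
  else 0

/-- The normalised character `χ̃_{a,b}^K(q)` of the `𝒲₃(3,K)` vertex operator algebra. -/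
def chiT (q : ℂ) (K a b : ℕ) : ℂ :=
  qPochInf (q ^ K) (q ^ K) ^ 2 / qPochInf q q ^ 2 *
    (theta (q ^ (a + 1)) (q ^ K) * theta (q ^ (b + 1)) (q ^ K) *
      theta (q ^ (a + b + 2)) (q ^ K))

/-- `f₁, …, f_k` read as a sequence indexed by `1, …, k` and extended by zero
(in particular `λ_{k+1} = 0`). -/
def nth {k : ℕ} (f : Fin k → ℕ) (i : ℕ) : ℕ :=
  if h : 1 ≤ i ∧ i ≤ k then f ⟨i - 1, by omega⟩ else 0

/-- `μ_1, …, μ_{k-1}` together with the boundary convention `μ_k := 2 λ_k`. -/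
def Mext {k : ℕ} (l : Fin k → ℕ) (m : Fin (k - 1) → ℕ) (i : ℕ) : ℕ :=
  if i = k then 2 * nth l k else nth m i

section

open Filter Topology

/-! ### q-factorials indexed by the integers -/

/-- `(q; q)_n` for integer `n`, with value `1` for negative `n`. -/
def qfac (q : ℂ) (n : ℤ) : ℂ := qPoch q q n.toNat

/-- `1 / (q; q)_n` for integer `n`, with value `0` for negative `n`. -/
def iq (q : ℂ) (n : ℤ) : ℂ := if 0 ≤ n then (qPoch q q n.toNat)⁻¹ else 0

lemma one_sub_pow_ne_zero {q : ℂ} (hq : ‖q‖ < 1) {n : ℕ} (hn : n ≠ 0) : 1 - q ^ n ≠ 0 := by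
  intro h
  have h1 : ‖q ^ n‖ < 1 := by rw [norm_pow]; exact pow_lt_one₀ (norm_nonneg _) hq hn
  rw [← sub_eq_zero.mp h] at h1
  simp at h1

lemma one_sub_zpow_ne_zero {q : ℂ} (hq0 : q ≠ 0) (hq : ‖q‖ < 1) {n : ℤ} (hn : n ≠ 0) :
    1 - q ^ n ≠ 0 := by
  obtain ⟨m, rfl | rfl⟩ := n.eq_nat_or_neg
  · simpa using one_sub_pow_ne_zero hq (n := m) (by simpa using hn)
  · have h1 := one_sub_pow_ne_zero hq (n := m) (by simpa using hn)
    intro h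
    apply h1
    rw [zpow_neg, zpow_natCast] at h
    have h2 : q ^ m ≠ 0 := pow_ne_zero _ hq0
    field_simp at h
    linear_combination -h

lemma qPoch_ne_zero {q : ℂ} (hq : ‖q‖ < 1) (n : ℕ) : qPoch q q n ≠ 0 := by
  refine Finset.prod_ne_zero_iff.mpr fun j _ => ?_
  rw [← pow_succ']
  exact one_sub_pow_ne_zero hq (by omega)

lemma qPoch_succ (q : ℂ) (n : ℕ) : qPoch q q (n + 1) = qPoch q q n * (1 - q ^ (n + 1)) := by
  rw [qPoch, Finset.prod_range_succ, ← pow_succ']; rfl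

lemma iq_of_neg {q : ℂ} {n : ℤ} (hn : n < 0) : iq q n = 0 := by
  rw [iq, if_neg (by omega)]

lemma iq_nonneg_of_ne_zero {q : ℂ} {n : ℤ} (h : iq q n ≠ 0) : 0 ≤ n := by
  by_contra h1
  exact h (iq_of_neg (by omega))

@[simp] lemma iq_zero (q : ℂ) : iq q 0 = 1 := by simp [iq, qPoch]

@[simp] lemma qfac_zero (q : ℂ) : qfac q 0 = 1 := by simp [qfac, qPoch]

lemma qfac_ne_zero {q : ℂ} (hq : ‖q‖ < 1) (n : ℤ) : qfac q n ≠ 0 := qPoch_ne_zero hq _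

lemma qfac_mul_iq {q : ℂ} (hq : ‖q‖ < 1) {n : ℤ} (hn : 0 ≤ n) : qfac q n * iq q n = 1 := by
  rw [qfac, iq, if_pos hn, mul_inv_cancel₀ (qPoch_ne_zero hq _)]

lemma qfac_succ {q : ℂ} {n : ℤ} (hn : 0 ≤ n) :
    qfac q (n + 1) = qfac q n * (1 - q ^ (n + 1)) := by
  lift n to ℕ using hn
  have := qPoch_succ q n
  rw [qfac, qfac, show ((n : ℤ) + 1).toNat = n + 1 by omega, Int.toNat_natCast, this]
  norm_cast

lemma iq_sub_one {q : ℂ} (hq : ‖q‖ < 1) (n : ℤ) : iq q (n - 1) = (1 - q ^ n) * iq q n := by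
  rcases lt_trichotomy n 0 with h | rfl | h
  · rw [iq_of_neg h, iq_of_neg (by omega), mul_zero]
  · rw [iq_of_neg (by omega)]; simp
  · have h1 := qfac_mul_iq hq (n := n) h.le
    have h2 := qfac_mul_iq hq (n := n - 1) (by omega)
    have h3 := qfac_succ (q := q) (n := n - 1) (by omega)
    rw [sub_add_cancel] at h3
    apply mul_left_cancel₀ (qfac_ne_zero hq (n - 1))
    rw [h2, ← mul_assoc, ← h3, h1]

lemma iq_eq_succ {q : ℂ} (hq : ‖q‖ < 1) (n : ℤ) : iq q n = (1 - q ^ (n + 1)) * iq q (n + 1) := by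
  rw [← iq_sub_one hq, add_sub_cancel_right]

/-! ### Sums over the integers with bounded support -/

lemma summable_of_Icc {f : ℤ → ℂ} (a b : ℤ) (h : ∀ n, f n ≠ 0 → a ≤ n ∧ n ≤ b) : Summable f := by
  apply summable_of_ne_finset_zero (s := Finset.Icc a b)
  intro n hn
  by_contra h1
  exact hn (Finset.mem_Icc.mpr (h n h1))

lemma tsum_eq_Icc {f : ℤ → ℂ} (a b : ℤ) (h : ∀ n, f n ≠ 0 → a ≤ n ∧ n ≤ b) :
    ∑' n, f n = ∑ n ∈ Finset.Icc a b, f n := by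
  apply tsum_eq_sum
  intro n hn
  by_contra h1
  exact hn (Finset.mem_Icc.mpr (h n h1))

lemma tsum_int_shift (f : ℤ → ℂ) (a : ℤ) : ∑' n, f (n + a) = ∑' n, f n :=
  (Equiv.addRight a).tsum_eq f

lemma summable_int_shift {f : ℤ → ℂ} (hf : Summable f) (a : ℤ) : Summable fun n => f (n + a) :=
  (Equiv.addRight a).summable_iff.mpr hf

/-- The q-Chu–Vandermonde sum. -/
lemma q_vandermonde {q : ℂ} (hq0 : q ≠ 0) (hq : ‖q‖ < 1) (n m d : ℤ) :
    ∑' r : ℤ, q ^ (r * (r + d)) * iq q (n - r) * iq q r * iq q (r + d) * iq q (m - r - d) =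
      qfac q (n + m) * iq q n * iq q m * iq q (n + d) * iq q (m - d) := by
  have supp : ∀ n m d : ℤ, ∀ r : ℤ, q ^ (r * (r + d)) * iq q (n - r) * iq q r * iq q (r + d) *
      iq q (m - r - d) ≠ 0 → 0 ≤ r ∧ r ≤ n := by
    intro n m d r h
    have h1 := iq_nonneg_of_ne_zero (right_ne_zero_of_mul (left_ne_zero_of_mul
      (left_ne_zero_of_mul (left_ne_zero_of_mul h))))
    have h2 := iq_nonneg_of_ne_zero (right_ne_zero_of_mul (left_ne_zero_of_mul
      (left_ne_zero_of_mul h)))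
    omega
  rcases lt_or_ge n 0 with hn | hn
  · rw [tsum_eq_Icc 0 n (supp n m d), Finset.Icc_eq_empty (by omega), iq_of_neg hn]; simp
  rcases lt_or_ge m 0 with hm | hm
  · rw [iq_of_neg hm, mul_zero, zero_mul, zero_mul]
    convert tsum_zero with r
    by_contra h
    have h1 := iq_nonneg_of_ne_zero (right_ne_zero_of_mul h)
    have h2 := iq_nonneg_of_ne_zero (right_ne_zero_of_mul (left_ne_zero_of_mul h))
    omega
  lift n to ℕ using hn
  induction n generalizing d with
  | zero =>
    rw [tsum_eq_Icc 0 0 (by exact_mod_cast supp 0 m d)]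
    have := qfac_mul_iq hq hm
    simp [this]
  | succ n ih =>
    have hS := fun d => summable_of_Icc 0 n (supp n m d)
    have e1 : ∀ r : ℤ, (1 - q ^ ((n : ℤ) + 1)) * (q ^ (r * (r + d)) * iq q (((n + 1 : ℕ) : ℤ) - r) *
        iq q r * iq q (r + d) * iq q (m - r - d)) =
        q ^ (r * (r + d)) * iq q (n - r) * iq q r * iq q (r + d) * iq q (m - r - d) +
        q ^ (n + 1 + d) * (q ^ ((r + -1) * (r + -1 + (d + 1))) * iq q (n - (r + -1)) *
          iq q (r + -1) * iq q (r + -1 + (d + 1)) * iq q (m - (r + -1) - (d + 1))) := by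
      intro r
      have h1 := iq_sub_one hq ((n : ℤ) + 1 - r)
      have h2 := iq_sub_one hq r
      rw [show (n : ℤ) + 1 - r - 1 = n - r by ring] at h1
      rw [show (n : ℤ) - (r + -1) = n + 1 - r by ring, show r + -1 + (d + 1) = r + d by ring,
        show m - (r + -1) - (d + 1) = m - r - d by ring, show r + -1 = r - 1 by ring, h1, h2]
      have h3 : q ^ (n + 1 + d) * q ^ ((r - 1) * (r + d)) =
          q ^ (r * (r + d)) * q ^ ((n : ℤ) + 1 - r) := by
        rw [← zpow_add₀ hq0, ← zpow_add₀ hq0]; ring_nf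
      have h4 : q ^ ((n : ℤ) + 1) = q ^ ((n : ℤ) + 1 - r) * q ^ r := by
        rw [← zpow_add₀ hq0]; ring_nf
      push_cast
      linear_combination (-(q ^ (r * (r + d)) * iq q (n + 1 - r) *
        iq q r * iq q (r + d) * iq q (m - r - d))) * h4 - iq q (n + 1 - r) * ((1 - q ^ r) *
        iq q r) * iq q (r + d) * iq q (m - r - d) * h3
    apply mul_left_cancel₀ (one_sub_zpow_ne_zero hq0 hq (n := (n : ℤ) + 1) (by omega))
    rw [← tsum_mul_left, tsum_congr e1, Summable.tsum_add (hS d), tsum_mul_left,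
      tsum_int_shift (fun r => q ^ (r * (r + (d + 1))) * iq q (n - r) * iq q r *
        iq q (r + (d + 1)) * iq q (m - r - (d + 1))) (-1), ih, ih]
    · have h1 := iq_eq_succ hq (n : ℤ)
      have h2 := iq_eq_succ hq (n + d)
      have h3 := iq_sub_one hq (m - d)
      have h4 := qfac_succ (q := q) (n := n + m) (by omega)
      rw [show ((n + 1 : ℕ) : ℤ) + m = n + m + 1 by push_cast; ring, h4,
        show ((n + 1 : ℕ) : ℤ) = n + 1 by push_cast; ring, h1,
        show (n : ℤ) + (d + 1) = n + d + 1 by ring, h2, show m - (d + 1) = m - d - 1 by ring, h3,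
        show (n : ℤ) + 1 + d = n + d + 1 by ring]
      have h5 : q ^ (n + m + 1) = q ^ (n + d + 1) * q ^ (m - d) := by
        rw [← zpow_add₀ hq0]; ring_nf
      rw [h5]; ring
    · apply Summable.mul_left
      exact summable_int_shift (hS (d + 1)) (-1)

lemma q_vandermonde_limit {q : ℂ} (hq0 : q ≠ 0) (hq : ‖q‖ < 1) (n d : ℤ) :
    ∑' r : ℤ, q ^ (r * (r + d)) * iq q (n - r) * iq q r * iq q (r + d) =
      iq q n * iq q (n + d) := by
  have supp : ∀ n d : ℤ, ∀ r : ℤ, q ^ (r * (r + d)) * iq q (n - r) * iq q r * iq q (r + d)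
      ≠ 0 → 0 ≤ r ∧ r ≤ n := by
    intro n d r h
    have h1 := iq_nonneg_of_ne_zero (right_ne_zero_of_mul
      (left_ne_zero_of_mul (left_ne_zero_of_mul h)))
    have h2 := iq_nonneg_of_ne_zero (right_ne_zero_of_mul (left_ne_zero_of_mul h))
    omega
  rcases lt_or_ge n 0 with hn | hn
  · rw [tsum_eq_Icc 0 n (supp n d), Finset.Icc_eq_empty (by omega), iq_of_neg hn]; simp
  lift n to ℕ using hn
  induction n generalizing d with
  | zero =>
    rw [tsum_eq_Icc 0 0 (by exact_mod_cast supp 0 d)]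
    simp
  | succ n ih =>
    have hS := fun d => summable_of_Icc 0 n (supp n d)
    have e1 : ∀ r : ℤ, (1 - q ^ ((n : ℤ) + 1)) * (q ^ (r * (r + d)) * iq q (((n + 1 : ℕ) : ℤ) - r) *
        iq q r * iq q (r + d)) =
        q ^ (r * (r + d)) * iq q (n - r) * iq q r * iq q (r + d) +
        q ^ (n + 1 + d) * (q ^ ((r + -1) * (r + -1 + (d + 1))) * iq q (n - (r + -1)) *
          iq q (r + -1) * iq q (r + -1 + (d + 1))) := by
      intro r
      have h1 := iq_sub_one hq ((n : ℤ) + 1 - r)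
      have h2 := iq_sub_one hq r
      rw [show (n : ℤ) + 1 - r - 1 = n - r by ring] at h1
      rw [show (n : ℤ) - (r + -1) = n + 1 - r by ring, show r + -1 + (d + 1) = r + d by ring,
        show r + -1 = r - 1 by ring, h1, h2]
      have h3 : q ^ (n + 1 + d) * q ^ ((r - 1) * (r + d)) =
          q ^ (r * (r + d)) * q ^ ((n : ℤ) + 1 - r) := by
        rw [← zpow_add₀ hq0, ← zpow_add₀ hq0]; ring_nf
      have h4 : q ^ ((n : ℤ) + 1) = q ^ ((n : ℤ) + 1 - r) * q ^ r := by
        rw [← zpow_add₀ hq0]; ring_nf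
      push_cast
      linear_combination (-(q ^ (r * (r + d)) * iq q (n + 1 - r) *
        iq q r * iq q (r + d))) * h4 - iq q (n + 1 - r) * ((1 - q ^ r) *
        iq q r) * iq q (r + d) * h3
    apply mul_left_cancel₀ (one_sub_zpow_ne_zero hq0 hq (n := (n : ℤ) + 1) (by omega))
    rw [← tsum_mul_left, tsum_congr e1, Summable.tsum_add (hS d), tsum_mul_left,
      tsum_int_shift (fun r => q ^ (r * (r + (d + 1))) * iq q (n - r) * iq q r *
        iq q (r + (d + 1))) (-1), ih, ih]
    · have h1 := iq_eq_succ hq (n : ℤ)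
      have h2 := iq_eq_succ hq (n + d)
      rw [show ((n + 1 : ℕ) : ℤ) = n + 1 by push_cast; ring, h1,
        show (n : ℤ) + (d + 1) = n + d + 1 by ring, h2,
        show (n : ℤ) + 1 + d = n + d + 1 by ring]
      ring
    · apply Summable.mul_left
      exact summable_int_shift (hS (d + 1)) (-1)

/-! ### A symmetric q-hypergeometric sum -/

/-- `∑_m q^{m² - l m} [l + d, m] / (q; q)_{m + c}`. -/
def symSum (q : ℂ) (l d c : ℤ) : ℂ :=
  ∑' m : ℤ, q ^ (m * m - l * m) * (qfac q (l + d) * iq q m * iq q (l + d - m)) * iq q (m + c)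

lemma symSum_supp {q : ℂ} {l d c m : ℤ}
    (h : q ^ (m * m - l * m) * (qfac q (l + d) * iq q m * iq q (l + d - m)) * iq q (m + c) ≠ 0) :
    0 ≤ m ∧ m ≤ l + d := by
  have h0 := right_ne_zero_of_mul (left_ne_zero_of_mul h)
  have h1 := iq_nonneg_of_ne_zero (right_ne_zero_of_mul h0)
  have h2 := iq_nonneg_of_ne_zero (right_ne_zero_of_mul (left_ne_zero_of_mul h0))
  omega

lemma symSum_rec {q : ℂ} (hq0 : q ≠ 0) (hq : ‖q‖ < 1) {l d c : ℤ} (hd : 0 ≤ l + d) :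
    q ^ c * symSum q l (d + 1) c - q ^ d * symSum q l d (c + 1) =
      (q ^ c - q ^ d) * symSum q l d c := by
  have hS := fun d c => summable_of_Icc 0 (l + d) (fun m => symSum_supp (q := q) (l := l)
    (d := d) (c := c))
  have e1 : symSum q l (d + 1) c - symSum q l d c = q ^ (d + 1) * ∑' m : ℤ, q ^ (m + -1) *
      (q ^ ((m + -1) * (m + -1) - l * (m + -1)) * (qfac q (l + d) * iq q (m + -1) *
        iq q (l + d - (m + -1))) * iq q (m + -1 + (c + 1))) := by
    rw [symSum, symSum, ← Summable.tsum_sub (hS _ _) (hS _ _), ← tsum_mul_left]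
    refine tsum_congr fun m => ?_
    have h1 := qfac_succ (q := q) hd
    have h2 := iq_sub_one hq m
    have h3 := iq_sub_one hq (l + d + 1 - m)
    rw [show l + d + 1 - m - 1 = l + d - m by ring] at h3
    rw [← add_assoc, h1, show m + -1 + (c + 1) = m + c by ring,
      show l + d - (m + -1) = l + d + 1 - m by ring, show m + -1 = m - 1 by ring, h2, h3]
    have h4 : q ^ (d + 1) * q ^ (m - 1) * q ^ ((m - 1) * (m - 1) - l * (m - 1)) =
        q ^ (m * m - l * m) * q ^ (l + d + 1 - m) := by
      rw [← zpow_add₀ hq0, ← zpow_add₀ hq0, ← zpow_add₀ hq0]; ring_nf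
    have h5 : q ^ (l + d + 1) = q ^ (l + d + 1 - m) * q ^ m := by
      rw [← zpow_add₀ hq0]; ring_nf
    rw [h5]
    linear_combination (-(qfac q (l + d) * ((1 - q ^ m) * iq q m) * iq q (l + d + 1 - m) *
      iq q (m + c))) * h4
  have e2 : symSum q l d (c + 1) - symSum q l d c = q ^ (c + 1) * ∑' m : ℤ, q ^ m *
      (q ^ (m * m - l * m) * (qfac q (l + d) * iq q m *
        iq q (l + d - m)) * iq q (m + (c + 1))) := by
    rw [symSum, symSum, ← Summable.tsum_sub (hS _ _) (hS _ _), ← tsum_mul_left]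
    refine tsum_congr fun m => ?_
    have h1 := iq_eq_succ hq (m + c)
    rw [h1, show m + (c + 1) = m + c + 1 by ring, show m + c + 1 = (c + 1) + m by ring,
      zpow_add₀ hq0]
    ring
  rw [tsum_int_shift (fun m => q ^ m * (q ^ (m * m - l * m) * (qfac q (l + d) * iq q m *
        iq q (l + d - m)) * iq q (m + (c + 1)))) (-1)] at e1
  have h1 : q ^ c * q ^ (d + 1) = q ^ d * q ^ (c + 1) := by
    rw [← zpow_add₀ hq0, ← zpow_add₀ hq0]; ring_nf
  linear_combination q ^ c * e1 - q ^ d * e2 + h1 * ∑' m : ℤ, q ^ m *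
      (q ^ (m * m - l * m) * (qfac q (l + d) * iq q m *
        iq q (l + d - m)) * iq q (m + (c + 1)))

lemma symSum_comm_aux {q : ℂ} (hq0 : q ≠ 0) (hq : ‖q‖ < 1) (l : ℤ) (g : ℕ) :
    ∀ c : ℤ, 0 ≤ l + c → symSum q l (c + g) c = symSum q l c (c + g) := by
  induction g using Nat.strong_induction_on with
  | _ g ih =>
    intro c hc
    match g with
    | 0 => simp
    | 1 =>
      have h := symSum_rec hq0 hq (c := c) hc
      have h1 : q ^ c ≠ 0 := zpow_ne_zero _ hq0
      push_cast
      rw [sub_self, zero_mul, sub_eq_zero] at h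
      exact mul_left_cancel₀ h1 h
    | g + 2 =>
      have h1 := symSum_rec hq0 hq (l := l) (d := c + (g + 1)) (c := c) (by omega)
      have h2 := symSum_rec hq0 hq (l := l) (d := c) (c := c + (g + 1)) (by omega)
      have h3 := ih (g + 1) (by omega) c hc
      have h4 := ih g (by omega) (c + 1) (by omega)
      push_cast at h3 h4 ⊢
      rw [show c + 1 + (g : ℤ) = c + (g + 1) by ring] at h4
      rw [show c + (g + 1) + (1 : ℤ) = c + (g + 2) by ring] at h1 h2
      apply mul_left_cancel₀ (zpow_ne_zero c hq0)
      linear_combination h1 + h2 + (q ^ c - q ^ (c + (g + 1) : ℤ)) * h3 +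
        q ^ (c + (g + 1) : ℤ) * h4

lemma symSum_comm {q : ℂ} (hq0 : q ≠ 0) (hq : ‖q‖ < 1) {l c d : ℤ} (hc : 0 ≤ l + c)
    (hd : 0 ≤ l + d) : symSum q l d c = symSum q l c d := by
  rcases le_total c d with h | h
  · obtain ⟨g, rfl⟩ := Int.le.dest h
    exact symSum_comm_aux hq0 hq l g c hc
  · obtain ⟨g, rfl⟩ := Int.le.dest h
    exact (symSum_comm_aux hq0 hq l g d hd).symm

lemma sum_eq_binomial_sum {q : ℂ} (hq0 : q ≠ 0) (hq : ‖q‖ < 1) {l c M : ℤ} (hc : 0 ≤ l + c)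
    (hM : 0 ≤ M) :
    ∑' m : ℤ, q ^ (m * m - l * m) * iq q (M - m) * iq q m * iq q (m + c) =
      ∑' n : ℤ, q ^ (n * n - l * n) * (qfac q (l + c) * iq q n * iq q (l + c - n)) *
        iq q M * iq q (M + n - l) := by
  have h := symSum_comm hq0 hq (l := l) (c := c) (d := M - l) hc (by omega)
  apply mul_left_cancel₀ (qfac_ne_zero hq M)
  rw [← tsum_mul_left, ← tsum_mul_left]
  rw [symSum, symSum] at h
  refine Eq.trans ?_ (h.trans ?_)
  · refine tsum_congr fun m => ?_
    rw [show l + (M - l) = M by ring]; ring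
  · refine tsum_congr fun m => ?_
    have h1 := qfac_mul_iq hq hM
    rw [show m + (M - l) = M + m - l by ring]
    linear_combination (-(q ^ (m * m - l * m) * (qfac q (l + c) * iq q m * iq q (l + c - m)) *
      iq q (M + m - l))) * h1

/-! ### The A₂ Bailey step -/

/-- `(q; q)_{L+M} / ∏_i (q; q)_{L - u_i} (q; q)_{M + u_i}`. -/
def ker (q : ℂ) (L M u v w : ℤ) : ℂ :=
  qfac q (L + M) * (iq q (L - u) * iq q (M + u)) * (iq q (L - v) * iq q (M + v)) *
    (iq q (L - w) * iq q (M + w))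

lemma ker_ne_zero {q : ℂ} {L M u v w : ℤ} (h : ker q L M u v w ≠ 0) :
    (u ≤ L ∧ -M ≤ u) ∧ (v ≤ L ∧ -M ≤ v) ∧ w ≤ L ∧ -M ≤ w := by
  have h1 := right_ne_zero_of_mul h
  have h2 := right_ne_zero_of_mul (left_ne_zero_of_mul h)
  have h3 := right_ne_zero_of_mul (left_ne_zero_of_mul (left_ne_zero_of_mul h))
  have a1 := iq_nonneg_of_ne_zero (left_ne_zero_of_mul h1)
  have a2 := iq_nonneg_of_ne_zero (right_ne_zero_of_mul h1)
  have a3 := iq_nonneg_of_ne_zero (left_ne_zero_of_mul h2)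
  have a4 := iq_nonneg_of_ne_zero (right_ne_zero_of_mul h2)
  have a5 := iq_nonneg_of_ne_zero (left_ne_zero_of_mul h3)
  have a6 := iq_nonneg_of_ne_zero (right_ne_zero_of_mul h3)
  omega

lemma ker_expand {q : ℂ} (hq0 : q ≠ 0) (hq : ‖q‖ < 1) (r s u v w : ℤ) :
    ker q r s u v w = ∑' t : ℤ, q ^ ((r - t) * (s + u + v - t)) * iq q (r - t) * iq q (t - v) *
      iq q (t - u) * iq q (s + u + v - t) * (iq q (r - w) * iq q (s + w)) := by
  have h := q_vandermonde hq0 hq (r - v) (s + v) (s + u + v - r)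
  rw [tsum_mul_right, ker]
  rw [show r - v + (s + v) = r + s by ring, show r - v + (s + u + v - r) = s + u by ring,
    show s + v - (s + u + v - r) = r - u by ring] at h
  congr 1
  rw [show qfac q (r + s) * (iq q (r - u) * iq q (s + u)) * (iq q (r - v) * iq q (s + v)) =
    qfac q (r + s) * iq q (r - v) * iq q (s + v) * iq q (s + u) * iq q (r - u) by ring, ← h]
  rw [← (Equiv.subLeft r).tsum_eq]
  refine tsum_congr fun t => ?_
  simp only [Equiv.subLeft_apply]
  rw [show r - t + (s + u + v - r) = s + u + v - t by ring,
    show r - v - (r - t) = t - v by ring,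
    show s + v - (r - t) - (s + u + v - r) = t - u by ring]
  ring

/-- One step of the A₂ Bailey lemma. -/
lemma bailey_step {q : ℂ} (hq0 : q ≠ 0) (hq : ‖q‖ < 1) (L M u v w : ℤ) (N : ℤ)
    (hN : |L| + |M| + |u| + |v| + |w| ≤ N) :
    ∑ r ∈ Finset.Icc (-N) N, ∑ s ∈ Finset.Icc (-N) N,
      q ^ (r * r - r * s + s * s - (u + v + w) * (r - s)) * iq q (L - r) * iq q (M - s) *
        ker q r s u v w =
      q ^ (-(u * v + u * w + v * w)) * ker q L M u v w := by
  have hr : ∀ t, ∑ r ∈ Finset.Icc (-N) N, q ^ ((r - t) * (r - w)) * iq q (L - r) * iq q (r - t) *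
      iq q (r - w) = iq q (L - t) * iq q (L - w) := by
    intro t
    have h := q_vandermonde_limit hq0 hq (L - t) (t - w)
    rw [show L - t + (t - w) = L - w by ring] at h
    rw [← h, ← tsum_int_shift _ (-t), ← tsum_eq_Icc]
    · refine tsum_congr fun r => ?_
      rw [show r + -t = r - t by ring, show r - t + (t - w) = r - w by ring,
        show L - t - (r - t) = L - r by ring]
    · intro r h
      have h1 := iq_nonneg_of_ne_zero (right_ne_zero_of_mul h)
      have h2 := iq_nonneg_of_ne_zero (right_ne_zero_of_mul (left_ne_zero_of_mul
        (left_ne_zero_of_mul h)))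
      grind
  have hs : ∀ t, ∑ s ∈ Finset.Icc (-N) N, q ^ ((s + w) * (s + u + v - t)) * iq q (M - s) *
      iq q (s + w) * iq q (s + u + v - t) = iq q (M + w) * iq q (M + u + v - t) := by
    intro t
    have h := q_vandermonde_limit hq0 hq (M + w) (u + v - t - w)
    rw [show M + w + (u + v - t - w) = M + u + v - t by ring] at h
    rw [← h, ← tsum_int_shift _ w, ← tsum_eq_Icc]
    · refine tsum_congr fun r => ?_
      rw [show r + w + (u + v - t - w) = r + u + v - t by ring,
        show M + w - (r + w) = M - r by ring]
    · intro r h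
      have h1 := iq_nonneg_of_ne_zero (right_ne_zero_of_mul (left_ne_zero_of_mul h))
      have h2 := iq_nonneg_of_ne_zero (right_ne_zero_of_mul (left_ne_zero_of_mul
        (left_ne_zero_of_mul h)))
      grind
  have ht : ∑ t ∈ Finset.Icc (-N) N, q ^ ((t - u) * (t - v)) * iq q (L - t) * iq q (t - u) *
      iq q (t - v) * iq q (M + u + v - t) =
      qfac q (L + M) * iq q (L - u) * iq q (M + u) * iq q (L - v) * iq q (M + v) := by
    have h := q_vandermonde hq0 hq (L - u) (M + u) (u - v)
    rw [show L - u + (u - v) = L - v by ring, show M + u - (u - v) = M + v by ring,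
      show L - u + (M + u) = L + M by ring] at h
    rw [← h, ← tsum_int_shift _ (-u), ← tsum_eq_Icc]
    · refine tsum_congr fun r => ?_
      rw [show r + -u + (u - v) = r - v by ring, show L - u - (r + -u) = L - r by ring,
        show M + u - (r + -u) - (u - v) = M + u + v - r by ring, show r + -u = r - u by ring]
    · intro r h
      have h1 := iq_nonneg_of_ne_zero (right_ne_zero_of_mul (left_ne_zero_of_mul h))
      have h2 := iq_nonneg_of_ne_zero (right_ne_zero_of_mul (left_ne_zero_of_mul
        (left_ne_zero_of_mul (left_ne_zero_of_mul h))))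
      grind
  have e1 : ∀ r ∈ Finset.Icc (-N) N, ∀ s ∈ Finset.Icc (-N) N,
      q ^ (r * r - r * s + s * s - (u + v + w) * (r - s)) * iq q (L - r) * iq q (M - s) *
        ker q r s u v w = ∑ t ∈ Finset.Icc (-N) N,
      q ^ ((t - u) * (t - v) - (u * v + u * w + v * w)) * iq q (t - u) * iq q (t - v) *
      ((q ^ ((r - t) * (r - w)) * iq q (L - r) * iq q (r - t) * iq q (r - w)) *
      (q ^ ((s + w) * (s + u + v - t)) * iq q (M - s) * iq q (s + w) *
        iq q (s + u + v - t))) := by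
    intro r hr s hs
    rw [Finset.mem_Icc] at hr hs
    rcases eq_or_ne (iq q (L - r)) 0 with h0 | h0
    · simp [h0]
    rw [ker_expand hq0 hq, tsum_eq_Icc (-N) N, Finset.mul_sum]
    · refine Finset.sum_congr rfl fun t _ => ?_
      have h : q ^ (r * r - r * s + s * s - (u + v + w) * (r - s)) *
          q ^ ((r - t) * (s + u + v - t)) =
          q ^ ((t - u) * (t - v) - (u * v + u * w + v * w)) * (q ^ ((r - t) * (r - w)) *
          q ^ ((s + w) * (s + u + v - t))) := by
        simp only [← zpow_add₀ hq0]; ring_nf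
      linear_combination (iq q (L - r) * iq q (M - s) * iq q (r - t) * iq q (t - v) *
        iq q (t - u) * iq q (s + u + v - t) * (iq q (r - w) * iq q (s + w))) * h
    · intro t h
      have h := left_ne_zero_of_mul (left_ne_zero_of_mul h)
      have h1 := iq_nonneg_of_ne_zero (right_ne_zero_of_mul h)
      have h2 := iq_nonneg_of_ne_zero (right_ne_zero_of_mul (left_ne_zero_of_mul
        (left_ne_zero_of_mul h)))
      grind
  rw [Finset.sum_congr rfl fun r hr => Finset.sum_congr rfl (e1 r hr)]
  rw [Finset.sum_congr rfl fun r hr => Finset.sum_comm, Finset.sum_comm]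
  simp_rw [← Finset.mul_sum, ← Finset.sum_mul, hs, hr]
  rw [ker]
  trans q ^ (-(u * v + u * w + v * w)) * (∑ t ∈ Finset.Icc (-N) N, q ^ ((t - u) * (t - v)) *
      iq q (L - t) * iq q (t - u) * iq q (t - v) * iq q (M + u + v - t)) *
      (iq q (L - w) * iq q (M + w))
  · rw [Finset.mul_sum, Finset.sum_mul]
    refine Finset.sum_congr rfl fun t _ => ?_
    rw [sub_eq_add_neg, zpow_add₀ hq0]
    ring
  · rw [ht]; ring

/-! ### Antisymmetric sums over the A₂ root lattice -/

/-- The character-like function modulo 3 with `1 ↦ -1`, `2 ↦ 1`, `0 ↦ 0`. -/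
def chi3 (m : ℤ) : ℂ := if m % 3 = 2 then 1 else if m % 3 = 1 then -1 else 0

lemma chi3_neg_of_add {m n : ℤ} (h : (m + n) % 3 = 0) : chi3 m = -chi3 n := by
  have h1 : m % 3 = 0 ∨ m % 3 = 1 ∨ m % 3 = 2 := by omega
  rcases h1 with h1 | h1 | h1
  · have h2 : n % 3 = 0 := by omega
    simp [chi3, h1, h2]
  · have h2 : n % 3 = 2 := by omega
    simp [chi3, h1, h2]
  · have h2 : n % 3 = 1 := by omega
    simp [chi3, h1, h2]

/-- The weight of the lattice point `(i, j, -i-j)`. -/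
def wt (q : ℂ) (K i j : ℤ) : ℂ := chi3 (2 * i + j) * q ^ (K * ((i * i + i * j + j * j - 1) / 3))

/-- The summand of `latSum`. -/
def latTerm (q : ℂ) (K : ℤ) (f : ℤ → ℤ → ℤ → ℂ) (p : ℤ × ℤ) : ℂ :=
  wt q K p.1 p.2 * f p.1 p.2 (-p.1 - p.2)

/-- The weighted sum of `f` over the points `(i, j, l)` with `i + j + l = 0`. -/
def latSum (q : ℂ) (K : ℤ) (f : ℤ → ℤ → ℤ → ℂ) : ℂ := ∑' p, latTerm q K f p

/-- The exchange of the last two coordinates on the root lattice. -/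
def latSwap : ℤ × ℤ ≃ ℤ × ℤ where
  toFun p := (p.1, -p.1 - p.2)
  invFun p := (p.1, -p.1 - p.2)
  left_inv p := by ext <;> simp
  right_inv p := by ext <;> simp

/-- An affine reflection of the root lattice. -/
def latRefl : ℤ × ℤ ≃ ℤ × ℤ where
  toFun p := (-p.1 - p.2 + 3, p.2)
  invFun p := (-p.1 - p.2 + 3, p.2)
  left_inv p := by ext <;> dsimp only; ring
  right_inv p := by ext <;> dsimp only; ring

lemma latTerm_swap12 (q : ℂ) (K : ℤ) (f : ℤ → ℤ → ℤ → ℂ) (p : ℤ × ℤ) :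
    latTerm q K (fun i j l => f j i l) (Equiv.prodComm ℤ ℤ p) = -latTerm q K f p := by
  obtain ⟨i, j⟩ := p
  simp only [latTerm, wt, Equiv.prodComm_apply, Prod.swap_prod_mk]
  rw [chi3_neg_of_add (m := 2 * j + i) (n := 2 * i + j) (by omega),
    show -j - i = -i - j by ring, show j * j + j * i + i * i = i * i + i * j + j * j by ring]
  ring

lemma latTerm_swap23 (q : ℂ) (K : ℤ) (f : ℤ → ℤ → ℤ → ℂ) (p : ℤ × ℤ) :
    latTerm q K (fun i j l => f i l j) (latSwap p) = -latTerm q K f p := by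
  obtain ⟨i, j⟩ := p
  simp only [latTerm, wt, latSwap, Equiv.coe_fn_mk]
  rw [chi3_neg_of_add (m := 2 * i + (-i - j)) (n := 2 * i + j) (by omega),
    show -i - (-i - j) = j by ring, show i * i + i * (-i - j) + (-i - j) * (-i - j) =
      i * i + i * j + j * j by ring]
  ring

lemma latSum_refl {q : ℂ} (hq0 : q ≠ 0) (K : ℤ) (f : ℤ → ℤ → ℤ → ℂ) :
    latSum q K f = -latSum q K (fun i j l => q ^ (K * (l - i + 3)) * f (l + 3) j (i - 3)) := by
  rw [latSum, latSum, ← latRefl.tsum_eq, ← tsum_neg]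
  refine tsum_congr fun p => ?_
  obtain ⟨i, j⟩ := p
  simp only [latTerm, wt, latRefl, Equiv.coe_fn_mk]
  rw [chi3_neg_of_add (m := 2 * (-i - j + 3) + j) (n := 2 * i + j) (by omega),
    show -(-i - j + 3) - j = i - 3 by ring,
    show (-i - j + 3) * (-i - j + 3) + (-i - j + 3) * j + j * j - 1 =
      (i * i + i * j + j * j - 1) + 3 * (-i - j - i + 3) by ring,
    Int.add_mul_ediv_left _ _ (by norm_num), mul_add, zpow_add₀ hq0]
  ring

/-- The antisymmetrization of a function of three variables. -/
def alt (f : ℤ → ℤ → ℤ → ℂ) (i j l : ℤ) : ℂ :=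
  f i j l - f j i l - f i l j + f j l i + f l i j - f l j i

lemma summable_swap12 {q : ℂ} {K : ℤ} {f : ℤ → ℤ → ℤ → ℂ} (hf : Summable (latTerm q K f)) :
    Summable (latTerm q K (fun i j l => f j i l)) := by
  rw [← (Equiv.prodComm ℤ ℤ).summable_iff]
  exact hf.neg.congr fun p => (latTerm_swap12 q K f p).symm

lemma summable_swap23 {q : ℂ} {K : ℤ} {f : ℤ → ℤ → ℤ → ℂ} (hf : Summable (latTerm q K f)) :
    Summable (latTerm q K (fun i j l => f i l j)) := by
  rw [← latSwap.summable_iff]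
  exact hf.neg.congr fun p => (latTerm_swap23 q K f p).symm

lemma latSum_swap12 (q : ℂ) (K : ℤ) (f : ℤ → ℤ → ℤ → ℂ) :
    latSum q K (fun i j l => f j i l) = -latSum q K f := by
  rw [latSum, latSum, ← (Equiv.prodComm ℤ ℤ).tsum_eq, ← tsum_neg]
  exact tsum_congr fun p => latTerm_swap12 q K f p

lemma latSum_swap23 (q : ℂ) (K : ℤ) (f : ℤ → ℤ → ℤ → ℂ) :
    latSum q K (fun i j l => f i l j) = -latSum q K f := by
  rw [latSum, latSum, ← latSwap.tsum_eq, ← tsum_neg]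
  exact tsum_congr fun p => latTerm_swap23 q K f p

lemma latSum_alt {q : ℂ} {K : ℤ} {f : ℤ → ℤ → ℤ → ℂ} (hf : Summable (latTerm q K f)) :
    latSum q K (alt f) = 6 * latSum q K f := by
  have s1 := summable_swap12 hf
  have s2 := summable_swap23 hf
  have s3 := summable_swap23 s1
  have s4 := summable_swap12 s2
  have s5 := summable_swap12 s3
  have e1 := latSum_swap12 q K f
  have e2 := latSum_swap23 q K f
  have e3 := latSum_swap23 q K (fun i j l => f j i l)
  have e4 := latSum_swap12 q K (fun i j l => f i l j)
  have e5 := latSum_swap12 q K (fun i j l => f l i j)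
  have h : latTerm q K (alt f) = fun p => latTerm q K f p - latTerm q K (fun i j l => f j i l) p -
      latTerm q K (fun i j l => f i l j) p + latTerm q K (fun i j l => f j l i) p +
      latTerm q K (fun i j l => f l i j) p - latTerm q K (fun i j l => f l j i) p := by
    funext p
    simp only [latTerm, alt]
    ring
  rw [latSum, h, Summable.tsum_sub ((((hf.sub s1).sub s2).add s4).add s3) s5,
    Summable.tsum_add (((hf.sub s1).sub s2).add s4) s3,
    Summable.tsum_add ((hf.sub s1).sub s2) s4, Summable.tsum_sub (hf.sub s1) s2,
    Summable.tsum_sub hf s1]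
  change latSum q K f - latSum q K (fun i j l => f j i l) - latSum q K (fun i j l => f i l j) +
    latSum q K (fun i j l => f j l i) + latSum q K (fun i j l => f l i j) -
    latSum q K (fun i j l => f l j i) = _
  rw [e5, e4, e3, e2, e1]
  ring

lemma latSum_congr {q : ℂ} {K : ℤ} {f g : ℤ → ℤ → ℤ → ℂ}
    (h : ∀ i j l, i + j + l = 0 → i ≠ j → j ≠ l → i ≠ l → f i j l = g i j l) :
    latSum q K f = latSum q K g := by
  refine tsum_congr fun p => ?_
  obtain ⟨i, j⟩ := p
  simp only [latTerm, wt]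
  by_cases h0 : (2 * i + j) % 3 = 0
  · simp [chi3, h0]
  · rw [h i j (-i - j) (by ring) (by omega) (by omega) (by omega)]

lemma latSum_eq_of_alt_eq {q : ℂ} {K : ℤ} {f g : ℤ → ℤ → ℤ → ℂ}
    (hf : Summable (latTerm q K f)) (hg : Summable (latTerm q K g))
    (h : ∀ i j l, i + j + l = 0 → i ≠ j → j ≠ l → i ≠ l → alt f i j l = alt g i j l) :
    latSum q K f = latSum q K g := by
  have h1 := latSum_alt hf
  have h2 := latSum_alt hg
  rw [latSum_congr h, h2] at h1
  linear_combination (-1 / 6) * h1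

lemma latTerm_summable_of_bound {q : ℂ} {K : ℤ} {f : ℤ → ℤ → ℤ → ℂ} (N : ℤ)
    (h : ∀ i j l, i + j + l = 0 → f i j l ≠ 0 → |i| ≤ N ∧ |j| ≤ N) :
    Summable (latTerm q K f) := by
  apply summable_of_ne_finset_zero (s := Finset.Icc (-N) N ×ˢ Finset.Icc (-N) N)
  rintro ⟨i, j⟩ hp
  rw [latTerm]
  by_contra h1
  have h2 := h i j (-i - j) (by ring) (right_ne_zero_of_mul h1)
  simp only [abs_le] at h2
  simp [h2] at hp

/-! ### The base identity -/

/-- `1 / ((q; q)_{L - i} (q; q)_{M + i})`. -/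
def slot (q : ℂ) (L M i : ℤ) : ℂ := iq q (L - i) * iq q (M + i)

lemma slot_ne_zero {q : ℂ} {L M i : ℤ} (h : slot q L M i ≠ 0) : -M ≤ i ∧ i ≤ L := by
  have a1 := iq_nonneg_of_ne_zero (left_ne_zero_of_mul h)
  have a2 := iq_nonneg_of_ne_zero (right_ne_zero_of_mul h)
  omega

lemma slot_left {q : ℂ} (hq0 : q ≠ 0) (hq : ‖q‖ < 1) (L M i : ℤ) :
    slot q (L - 1) M i = (1 - q ^ L * (q ^ i)⁻¹) * slot q L M i := by
  have h := iq_sub_one hq (L - i)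
  rw [slot, slot, show L - 1 - i = L - i - 1 by ring, h, zpow_sub₀ hq0]
  ring

lemma slot_right {q : ℂ} (hq0 : q ≠ 0) (hq : ‖q‖ < 1) (L M i : ℤ) :
    slot q L (M - 1) i = (1 - q ^ M * q ^ i) * slot q L M i := by
  have h := iq_sub_one hq (M + i)
  rw [slot, slot, show M - 1 + i = M + i - 1 by ring, h, zpow_add₀ hq0]
  ring

/-- The product of three slots. -/
def slots (q : ℂ) (L M i j l : ℤ) : ℂ := slot q L M i * slot q L M j * slot q L M l

lemma slots_summable {q : ℂ} {K L M : ℤ} (g : ℤ → ℤ → ℤ → ℂ) :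
    Summable (latTerm q K (fun i j l => g i j l * slots q L M i j l)) := by
  refine latTerm_summable_of_bound (|L| + |M|) fun i j l _ h => ?_
  have h1 := right_ne_zero_of_mul h
  have h2 := slot_ne_zero (left_ne_zero_of_mul (left_ne_zero_of_mul h1))
  have h3 := slot_ne_zero (right_ne_zero_of_mul (left_ne_zero_of_mul h1))
  grind

/-- The base sum at level two. -/
def baseSum (q : ℂ) (L M : ℤ) : ℂ :=
  latSum q 2 (fun i j l => q ^ (l - i) * slots q L M i j l)

/-- The pointwise factor of the reflected summands. -/
def reflW (q X Y x z : ℂ) : ℂ :=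
  x⁻¹ ^ 2 * ((1 - Y * x) * (q - Y * x) * (q ^ 2 - Y * x)) *
    ((1 - X * z⁻¹) * (q - X * z⁻¹) * (q ^ 2 - X * z⁻¹))

lemma base_cert {a b c X Y q : ℂ} (ha : a ≠ 0) (hb : b ≠ 0) (hc : c = (a * b)⁻¹)
    (hX : X ≠ 0) (hY : Y ≠ 0) (PX PY : ℂ)
    (hPX : PX = (1 - X * a⁻¹) * (1 - X * b⁻¹) * (1 - X * c⁻¹))
    (hPY : PY = (1 - Y * a) * (1 - Y * b) * (1 - Y * c)) (R : ℂ → ℂ → ℂ → ℂ)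
    (hR : ∀ x y z, R x y z = ((X * Y + X ^ 2 * Y ^ 2) * y⁻¹ - X ^ 2 * Y * y⁻¹ ^ 2 - X * Y ^ 2) *
      reflW q X Y x z) :
    (a * c⁻¹ - b * c⁻¹ - a * b⁻¹ + b * a⁻¹ + c * b⁻¹ - c * a⁻¹) *
      (X ^ 3 * Y ^ 3 * PX * PY - X * Y * ((q - X * Y) ^ 2 * (q ^ 2 - X * Y) ^ 2 * (1 - X * Y)
      - ((q - X * Y) * (q ^ 2 - X * Y)) * (Y ^ 3 * PX + X ^ 3 * PY))) =
      R a b c - R b a c - R a c b + R b c a + R c a b - R c b a := by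
  subst hc
  simp only [hR, hPX, hPY, reflW]
  field_simp
  ring

/-- The summand whose weighted sum vanishes by affine reflection. -/
def reflTerm (q : ℂ) (L M d i j l : ℤ) : ℂ :=
  q ^ (6 + -2 * i + d * j) * (slot q L (M - 3) i * slot q L M j * slot q (L - 3) M l)

lemma reflTerm_sum {q : ℂ} (hq0 : q ≠ 0) (L M d : ℤ) : latSum q 2 (reflTerm q L M d) = 0 := by
  have h := latSum_refl hq0 2 (reflTerm q L M d)
  have h1 : (fun i j l => q ^ (2 * (l - i + 3)) * reflTerm q L M d (l + 3) j (i - 3)) =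
      reflTerm q L M d := by
    funext i j l
    simp only [reflTerm, slot]
    rw [show L - (l + 3) = L - 3 - l by ring, show M - 3 + (l + 3) = M + l by ring,
      show L - 3 - (i - 3) = L - i by ring, show M + (i - 3) = M - 3 + i by ring,
      show 6 + -2 * i + d * j = 2 * (l - i + 3) + (6 + -2 * (l + 3) + d * j) by ring,
      zpow_add₀ hq0 (2 * (l - i + 3))]
    ring
  rw [h1] at h
  linear_combination h / 2

lemma reflTerm_eq {q : ℂ} (hq0 : q ≠ 0) (hq : ‖q‖ < 1) (L M d i j l : ℤ) :
    reflTerm q L M d i j l = (q ^ j) ^ d * reflW q (q ^ L) (q ^ M) (q ^ i) (q ^ l) *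
      slots q L M i j l := by
  rw [reflW, reflTerm, slots, show M - 3 = M - 1 - 1 - 1 by ring, slot_right hq0 hq, slot_right hq0 hq,
    slot_right hq0 hq, show L - 3 = L - 1 - 1 - 1 by ring, slot_left hq0 hq, slot_left hq0 hq,
    slot_left hq0 hq, zpow_add₀ hq0, zpow_add₀ hq0, mul_comm d j, zpow_mul q j,
    mul_comm (-2) i, zpow_mul q i]
  have e1 : ∀ n : ℤ, q ^ (n - 1) = q ^ n * q⁻¹ := fun n => by rw [zpow_sub₀ hq0]; simp [div_eq_mul_inv]
  have e2 : (q ^ i) ^ (-2 : ℤ) = (q ^ i)⁻¹ ^ 2 := by rw [zpow_neg, inv_pow]; norm_cast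
  have e3 : q ^ (6 : ℤ) = q ^ 6 := by norm_cast
  rw [e1, e1, e1, e1, e2, e3]
  generalize (q ^ i)⁻¹ = a', q ^ i = a, (q ^ l)⁻¹ = c', (q ^ j) ^ d = b
  field_simp

lemma latSum_const_mul (q : ℂ) (K : ℤ) (c : ℂ) (f : ℤ → ℤ → ℤ → ℂ) :
    latSum q K (fun i j l => c * f i j l) = c * latSum q K f := by
  rw [latSum, latSum, ← tsum_mul_left]
  refine tsum_congr fun p => ?_
  simp only [latTerm]
  ring

lemma latTerm_summable_const_mul {q : ℂ} {K : ℤ} (c : ℂ) {f : ℤ → ℤ → ℤ → ℂ}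
    (hf : Summable (latTerm q K f)) : Summable (latTerm q K (fun i j l => c * f i j l)) := by
  refine (hf.mul_left c).congr fun p => ?_
  simp only [latTerm]
  ring

lemma latSum_add {q : ℂ} {K : ℤ} {f g : ℤ → ℤ → ℤ → ℂ} (hf : Summable (latTerm q K f))
    (hg : Summable (latTerm q K g)) :
    latSum q K (fun i j l => f i j l + g i j l) = latSum q K f + latSum q K g := by
  rw [latSum, latSum, latSum, ← Summable.tsum_add hf hg]
  refine tsum_congr fun p => ?_
  simp only [latTerm]
  ring

lemma latTerm_summable_add {q : ℂ} {K : ℤ} {f g : ℤ → ℤ → ℤ → ℂ} (hf : Summable (latTerm q K f))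
    (hg : Summable (latTerm q K g)) :
    Summable (latTerm q K (fun i j l => f i j l + g i j l)) := by
  refine (hf.add hg).congr fun p => ?_
  simp only [latTerm]
  ring

lemma reflTerm_summable {q : ℂ} (hq0 : q ≠ 0) (hq : ‖q‖ < 1) (L M d : ℤ) :
    Summable (latTerm q 2 (reflTerm q L M d)) := by
  have : reflTerm q L M d = fun i j l => (q ^ j) ^ d * reflW q (q ^ L) (q ^ M) (q ^ i) (q ^ l) *
      slots q L M i j l := by
    funext i j l
    exact reflTerm_eq hq0 hq L M d i j l
  rw [this]
  exact slots_summable _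

lemma slots_left {q : ℂ} (hq0 : q ≠ 0) (hq : ‖q‖ < 1) (L M i j l : ℤ) :
    slots q (L - 1) M i j l = (1 - q ^ L * (q ^ i)⁻¹) * (1 - q ^ L * (q ^ j)⁻¹) *
      (1 - q ^ L * (q ^ l)⁻¹) * slots q L M i j l := by
  rw [slots, slot_left hq0 hq, slot_left hq0 hq, slot_left hq0 hq, slots]
  ring

lemma slots_right {q : ℂ} (hq0 : q ≠ 0) (hq : ‖q‖ < 1) (L M i j l : ℤ) :
    slots q L (M - 1) i j l = (1 - q ^ M * q ^ i) * (1 - q ^ M * q ^ j) *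
      (1 - q ^ M * q ^ l) * slots q L M i j l := by
  rw [slots, slot_right hq0 hq, slot_right hq0 hq, slot_right hq0 hq, slots]
  ring

lemma slots_swap12 (q : ℂ) (L M i j l : ℤ) : slots q L M j i l = slots q L M i j l := by
  rw [slots, slots]; ring

lemma slots_swap23 (q : ℂ) (L M i j l : ℤ) : slots q L M i l j = slots q L M i j l := by
  rw [slots, slots]; ring

lemma baseSum_rec {q : ℂ} (hq0 : q ≠ 0) (hq : ‖q‖ < 1) (L M : ℤ) :
    (q ^ L) ^ 3 * (q ^ M) ^ 3 * baseSum q (L - 1) (M - 1) =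
      q ^ L * q ^ M * ((q - q ^ L * q ^ M) ^ 2 * (q ^ 2 - q ^ L * q ^ M) ^ 2 *
        (1 - q ^ L * q ^ M) * baseSum q L M -
      (q - q ^ L * q ^ M) * (q ^ 2 - q ^ L * q ^ M) *
        ((q ^ M) ^ 3 * baseSum q (L - 1) M + (q ^ L) ^ 3 * baseSum q L (M - 1))) := by
  set X := q ^ L with hX
  set Y := q ^ M with hY
  have hX0 : X ≠ 0 := zpow_ne_zero _ hq0
  have hY0 : Y ≠ 0 := zpow_ne_zero _ hq0
  set A : ℂ := X ^ 3 * Y ^ 3 with hA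
  set B : ℂ := -(X * Y * ((q - X * Y) ^ 2 * (q ^ 2 - X * Y) ^ 2 * (1 - X * Y))) with hB
  set C : ℂ := X * Y * ((q - X * Y) * (q ^ 2 - X * Y)) with hC
  have s : ∀ (c : ℂ) (L M : ℤ), Summable (latTerm q 2 (fun i j l => c *
      (q ^ (l - i) * slots q L M i j l))) :=
    fun c L M => latTerm_summable_const_mul c (slots_summable _)
  have r : ∀ (c : ℂ) (d : ℤ), Summable (latTerm q 2 (fun i j l => c * reflTerm q L M d i j l)) :=
    fun c d => latTerm_summable_const_mul c (reflTerm_summable hq0 hq L M d)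
  have e1 : latSum q 2 (fun i j l => ((A * (q ^ (l - i) * slots q (L - 1) (M - 1) i j l) +
      B * (q ^ (l - i) * slots q L M i j l)) +
      C * Y ^ 3 * (q ^ (l - i) * slots q (L - 1) M i j l)) +
      C * X ^ 3 * (q ^ (l - i) * slots q L (M - 1) i j l)) =
    A * baseSum q (L - 1) (M - 1) + B * baseSum q L M + C * Y ^ 3 * baseSum q (L - 1) M +
      C * X ^ 3 * baseSum q L (M - 1) := by
    rw [latSum_add (latTerm_summable_add (latTerm_summable_add (s _ _ _) (s _ _ _)) (s _ _ _))
      (s _ _ _), latSum_add (latTerm_summable_add (s _ _ _) (s _ _ _)) (s _ _ _),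
      latSum_add (s _ _ _) (s _ _ _)]
    simp only [latSum_const_mul, baseSum]
  have e2 : latSum q 2 (fun i j l => (-((X * Y + X ^ 2 * Y ^ 2)) *
      reflTerm q L M (-1) i j l + (X ^ 2 * Y) * reflTerm q L M (-2) i j l) +
      (X * Y ^ 2) * reflTerm q L M 0 i j l) = 0 := by
    rw [latSum_add (latTerm_summable_add (r _ _) (r _ _)) (r _ _), latSum_add (r _ _) (r _ _)]
    simp only [latSum_const_mul, reflTerm_sum hq0]
    ring
  have e3 := latSum_eq_of_alt_eq (latTerm_summable_add (latTerm_summable_add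
    (latTerm_summable_add (s A (L - 1) (M - 1)) (s B L M)) (s (C * Y ^ 3) (L - 1) M))
    (s (C * X ^ 3) L (M - 1)))
    (latTerm_summable_add (latTerm_summable_add (r (-((X * Y + X ^ 2 * Y ^ 2))) (-1))
      (r (X ^ 2 * Y) (-2))) (r (X * Y ^ 2) 0)) ?_
  · rw [e1, e2] at e3
    linear_combination e3
  · intro i j l hijl _ _ _
    have hl : q ^ l = (q ^ i * q ^ j)⁻¹ := by
      rw [← zpow_add₀ hq0, ← zpow_neg]; congr 1; omega
    have cert := base_cert (q := q) (zpow_ne_zero i hq0) (zpow_ne_zero j hq0) hl hX0 hY0 _ _ rfl rfl _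
      (fun x y z => rfl)
    have p1 : ∀ L M, slots q L M j i l = slots q L M i j l := fun L M => slots_swap12 ..
    have p2 : ∀ L M, slots q L M i l j = slots q L M i j l := fun L M => slots_swap23 ..
    have p3 : ∀ L M, slots q L M j l i = slots q L M i j l := fun L M => by
      rw [slots_swap23, slots_swap12]
    have p4 : ∀ L M, slots q L M l i j = slots q L M i j l := fun L M => by
      rw [slots_swap12, slots_swap23]
    have p5 : ∀ L M, slots q L M l j i = slots q L M i j l := fun L M => by
      rw [slots_swap12, slots_swap23, slots_swap12]
    simp only [alt, reflTerm_eq hq0 hq, p1, p2, p3, p4, p5]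
    simp only [slots_left hq0 hq, slots_right hq0 hq, ← hX, ← hY, zpow_sub₀ hq0, zpow_neg,
      hA, hB, hC, div_eq_mul_inv, inv_pow, zpow_ofNat, pow_one] at cert ⊢
    generalize (1 - X * (q ^ i)⁻¹) * (1 - X * (q ^ j)⁻¹) * (1 - X * (q ^ l)⁻¹) = PX,
      (1 - Y * q ^ i) * (1 - Y * q ^ j) * (1 - Y * q ^ l) = PY,
      reflW q X Y (q ^ i) (q ^ j) = w1, reflW q X Y (q ^ i) (q ^ l) = w2,
      reflW q X Y (q ^ j) (q ^ i) = w3, reflW q X Y (q ^ j) (q ^ l) = w4,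
      reflW q X Y (q ^ l) (q ^ i) = w5, reflW q X Y (q ^ l) (q ^ j) = w6,
      (q - X * Y) = u1, (q ^ 2 - X * Y) = u2, 1 - X * Y = u3, slots q L M i j l = s0 at cert ⊢
    generalize (q ^ i)⁻¹ = a', (q ^ j)⁻¹ = b', (q ^ l)⁻¹ = c' at cert ⊢
    generalize q ^ i = a, q ^ j = b, q ^ l = c at cert ⊢
    linear_combination (-s0) * cert

/-- The closed form of `baseSum`. -/
def baseVal (q : ℂ) (L M : ℤ) : ℂ :=
  q ^ (-2 + 2 * (L - 1) * (M - 1)) * iq q (L - 1) * iq q (M - 1) * iq q (L + M - 1) * iq q (L + M)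

lemma baseVal_left {q : ℂ} (hq0 : q ≠ 0) (hq : ‖q‖ < 1) (L M : ℤ) :
    (q ^ M) ^ 2 * baseVal q (L - 1) M =
      (q - q ^ L) * (q - q ^ L * q ^ M) * (1 - q ^ L * q ^ M) * baseVal q L M := by
  rw [baseVal, show -2 + 2 * (L - 1 - 1) * (M - 1) = (-2 + 2 * (L - 1) * (M - 1)) + 2 + -(M * 2) by
    ring, iq_sub_one hq (L - 1), show L - 1 + M - 1 = L + M - 1 - 1 by ring,
    iq_sub_one hq (L + M - 1), show L - 1 + M = L + M - 1 by ring, iq_sub_one hq (L + M), baseVal]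
  simp only [iq_sub_one hq (L + M), zpow_sub₀ hq0, zpow_add₀ hq0 _ (-(M * 2)),
    zpow_add₀ hq0 _ (2 : ℤ), zpow_add₀ hq0 L M, zpow_neg, zpow_mul q M, zpow_ofNat]
  have := zpow_ne_zero M hq0
  field_simp

lemma baseVal_comm (q : ℂ) (L M : ℤ) : baseVal q L M = baseVal q M L := by
  rw [baseVal, baseVal, add_comm M L, show 2 * (M - 1) * (L - 1) = 2 * (L - 1) * (M - 1) by ring]
  ring

lemma baseVal_rec {q : ℂ} (hq0 : q ≠ 0) (hq : ‖q‖ < 1) (L M : ℤ) :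
    (q ^ L) ^ 3 * (q ^ M) ^ 3 * baseVal q (L - 1) (M - 1) =
      q ^ L * q ^ M * ((q - q ^ L * q ^ M) ^ 2 * (q ^ 2 - q ^ L * q ^ M) ^ 2 *
        (1 - q ^ L * q ^ M) * baseVal q L M -
      (q - q ^ L * q ^ M) * (q ^ 2 - q ^ L * q ^ M) *
        ((q ^ M) ^ 3 * baseVal q (L - 1) M + (q ^ L) ^ 3 * baseVal q L (M - 1))) := by
  have h1 := baseVal_left hq0 hq L M
  have h2 := baseVal_left hq0 hq M L
  have h3 := baseVal_left hq0 hq M (L - 1)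
  rw [baseVal_comm q (M - 1), baseVal_comm q M] at h2 h3
  rw [zpow_sub₀ hq0, zpow_one] at h3
  have hX : q ^ L ≠ 0 := zpow_ne_zero _ hq0
  have hY : q ^ M ≠ 0 := zpow_ne_zero _ hq0
  generalize q ^ L = X, q ^ M = Y at *
  have e1 : baseVal q (L - 1) M = (q - X) * (q - X * Y) * (1 - X * Y) * baseVal q L M / Y ^ 2 := by
    field_simp; linear_combination h1
  have e2 : baseVal q L (M - 1) = (q - Y) * (q - Y * X) * (1 - Y * X) * baseVal q L M / X ^ 2 := by
    field_simp; linear_combination h2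
  have e3 : baseVal q (L - 1) (M - 1) =
      (q - Y) * (q - Y * (X / q)) * (1 - Y * (X / q)) * baseVal q (L - 1) M / (X / q) ^ 2 := by
    field_simp; field_simp at h3; linear_combination h3
  rw [e3, e2, e1]
  field_simp
  ring

lemma baseSum_eq_zero {q : ℂ} {L M : ℤ} (h : L = 0 ∨ M = 0) : baseSum q L M = 0 := by
  have h1 : baseSum q L M = latSum q 2 (fun _ _ _ => 0) := by
    refine latSum_congr fun i j l hs hij hjl _ => ?_
    by_contra h2
    have h3 := right_ne_zero_of_mul h2
    have a1 := slot_ne_zero (left_ne_zero_of_mul (left_ne_zero_of_mul h3))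
    have a2 := slot_ne_zero (right_ne_zero_of_mul (left_ne_zero_of_mul h3))
    have a3 := slot_ne_zero (right_ne_zero_of_mul h3)
    omega
  rw [h1, latSum]
  simp [latTerm]

lemma baseSum_one_one {q : ℂ} (hq0 : q ≠ 0) (hq : ‖q‖ < 1) : baseSum q 1 1 = baseVal q 1 1 := by
  rw [baseSum, latSum, tsum_eq_sum (s := Finset.Icc (-1) 1 ×ˢ Finset.Icc (-1) 1)]
  · have hI : Finset.Icc (-1 : ℤ) 1 = {-1, 0, 1} := by decide
    have h0 : iq q 0 = 1 := iq_zero q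
    have h1 := iq_sub_one hq 1
    have h2 := iq_sub_one hq 2
    have n1 : (1 - q) ≠ 0 := by simpa using one_sub_pow_ne_zero hq (n := 1) (by norm_num)
    have n2 : (1 - q ^ 2) ≠ 0 := one_sub_pow_ne_zero hq (n := 2) (by norm_num)
    norm_num [h0] at h1 h2
    have h1' : iq q 1 = 1 / (1 - q) := by field_simp; linear_combination -h1
    have h2' : iq q 2 = 1 / ((1 - q) * (1 - q ^ 2)) := by
      rw [h1'] at h2; field_simp at h2 ⊢; norm_cast at h2; linear_combination -h2
    rw [Finset.sum_product, hI]
    simp [latTerm, wt, chi3, slots, slot, baseVal, h0, h1', h2']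
    have e : 1 - q ^ 2 = (1 - q) * (1 + q) := by ring
    rw [e] at n2 ⊢
    have n3 := right_ne_zero_of_mul n2
    field_simp
    ring
  · rintro ⟨i, j⟩ hp
    simp only [latTerm]
    by_contra h2
    have h3 := right_ne_zero_of_mul (right_ne_zero_of_mul h2)
    have a1 := slot_ne_zero (left_ne_zero_of_mul (left_ne_zero_of_mul h3))
    have a2 := slot_ne_zero (right_ne_zero_of_mul (left_ne_zero_of_mul h3))
    simp [a1, a2] at hp

lemma baseSum_eq_baseVal {q : ℂ} (hq0 : q ≠ 0) (hq : ‖q‖ < 1) (n : ℕ) :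
    ∀ L M : ℤ, 0 ≤ L → 0 ≤ M → L + M = n → baseSum q L M = baseVal q L M := by
  induction n using Nat.strong_induction_on with
  | _ n ih =>
    intro L M hL hM hn
    by_cases h0 : L = 0 ∨ M = 0
    · rw [baseSum_eq_zero h0, baseVal]
      rcases h0 with rfl | rfl <;> simp [iq_of_neg]
    by_cases h1 : L + M = 2
    · obtain ⟨rfl, rfl⟩ : L = 1 ∧ M = 1 := by omega
      exact baseSum_one_one hq0 hq
    have r1 := baseSum_rec hq0 hq L M
    have r2 := baseVal_rec hq0 hq L M
    rw [ih (n - 2) (by omega) (L - 1) (M - 1) (by omega) (by omega) (by omega),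
      ih (n - 1) (by omega) (L - 1) M (by omega) (by omega) (by omega),
      ih (n - 1) (by omega) L (M - 1) (by omega) (by omega) (by omega)] at r1
    have hX : q ^ L ≠ 0 := zpow_ne_zero _ hq0
    have hY : q ^ M ≠ 0 := zpow_ne_zero _ hq0
    have d : ∀ m : ℤ, L + M ≠ m → q ^ m - q ^ L * q ^ M ≠ 0 := by
      intro m hm
      have := mul_ne_zero (zpow_ne_zero m hq0) (one_sub_zpow_ne_zero hq0 hq
        (n := L + M - m) (by omega))
      rwa [mul_sub, ← zpow_add₀ hq0, mul_one, show m + (L + M - m) = L + M by ring,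
        zpow_add₀ hq0] at this
    have d0 := d 0 (by omega)
    have d1 := d 1 (by omega)
    have d2 := d 2 (by omega)
    rw [zpow_zero] at d0
    rw [zpow_one] at d1
    rw [zpow_ofNat] at d2
    have : q ^ L * q ^ M * ((q - q ^ L * q ^ M) ^ 2 * (q ^ 2 - q ^ L * q ^ M) ^ 2 *
        (1 - q ^ L * q ^ M)) ≠ 0 :=
      mul_ne_zero (mul_ne_zero hX hY) (mul_ne_zero (mul_ne_zero (pow_ne_zero 2 d1)
        (pow_ne_zero 2 d2)) d0)
    apply mul_left_cancel₀ this
    linear_combination r2 - r1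

/-! ### Bailey chains -/

/-- One step of the `A₂` Bailey chain with linear exponents `x`, `y`. -/
def stepA (q : ℂ) (x y : ℤ) (C : ℤ → ℤ → ℂ) (L M : ℤ) : ℂ :=
  ∑ r ∈ Finset.Icc 0 L, ∑ s ∈ Finset.Icc 0 M,
    q ^ (r * r - r * s + s * s + x * r + y * s) * iq q (L - r) * iq q (M - s) * C r s

/-- The chain of length `k` whose `i`-th step has exponents `[i > a]` and `[i > b]`. -/
def chain (q : ℂ) : ℕ → ℕ → ℕ → (ℤ → ℤ → ℂ) → ℤ → ℤ → ℂ
  | 0, _, _, C => C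
  | k + 1, a, b, C =>
    stepA q (if a = 0 then 1 else 0) (if b = 0 then 1 else 0) (chain q k (a - 1) (b - 1) C)

lemma stepA_congr {q : ℂ} {x y : ℤ} {C D : ℤ → ℤ → ℂ} (h : ∀ r s, 0 ≤ r → 0 ≤ s → C r s = D r s)
    (L M : ℤ) : stepA q x y C L M = stepA q x y D L M := by
  refine Finset.sum_congr rfl fun r hr => Finset.sum_congr rfl fun s hs => ?_
  rw [h r s (Finset.mem_Icc.1 hr).1 (Finset.mem_Icc.1 hs).1]

lemma stepA_swap (q : ℂ) (x y : ℤ) (C : ℤ → ℤ → ℂ) (L M : ℤ) :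
    stepA q x y C L M = stepA q y x (fun r s => C s r) M L := by
  rw [stepA, stepA, Finset.sum_comm]
  refine Finset.sum_congr rfl fun s _ => Finset.sum_congr rfl fun r _ => ?_
  rw [show r * r - r * s + s * s + x * r + y * s = s * s - s * r + r * r + y * s + x * r by ring]
  ring

lemma chain_swap {q : ℂ} {C : ℤ → ℤ → ℂ} (hC : ∀ r s, C r s = C s r) (k : ℕ) :
    ∀ (a b : ℕ) (L M : ℤ), chain q k a b C L M = chain q k b a C M L := by
  induction k with
  | zero => intro _ _ L M; exact hC L M
  | succ k ih =>
    intro a b L M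
    rw [chain, chain, stepA_swap]
    exact stepA_congr (fun r s _ _ => ih ..) ..

lemma stepA_sub_mul (q : ℂ) (x y : ℤ) (c : ℂ) (C D : ℤ → ℤ → ℂ) (L M : ℤ) :
    stepA q x y (fun r s => C r s - c * D r s) L M = stepA q x y C L M - c * stepA q x y D L M := by
  simp only [stepA, Finset.mul_sum, ← Finset.sum_sub_distrib]
  refine Finset.sum_congr rfl fun s _ => Finset.sum_congr rfl fun r _ => ?_
  ring

lemma stepA_mul (q : ℂ) (x y : ℤ) (c : ℂ) (C : ℤ → ℤ → ℂ) (L M : ℤ) :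
    stepA q x y (fun r s => c * C r s) L M = c * stepA q x y C L M := by
  simp only [stepA, Finset.mul_sum]
  refine Finset.sum_congr rfl fun s _ => Finset.sum_congr rfl fun r _ => ?_
  ring

lemma latSum_pow_mul {q : ℂ} (hq0 : q ≠ 0) (K : ℤ) (f : ℤ → ℤ → ℤ → ℂ) :
    latSum q K (fun i j l => q ^ (i * i + i * j + j * j) * f i j l) = q * latSum q (K + 3) f := by
  rw [← latSum_const_mul]
  refine tsum_congr fun p => ?_
  obtain ⟨i, j⟩ := p
  simp only [latTerm, wt]
  by_cases h0 : (2 * i + j) % 3 = 0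
  · simp [chi3, h0]
  · have h1 : (i * i + i * j + j * j - 1) % 3 = 0 := by
      have a1 : i % 3 = 0 ∨ i % 3 = 1 ∨ i % 3 = 2 := by omega
      have a2 : j % 3 = 0 ∨ j % 3 = 1 ∨ j % 3 = 2 := by omega
      rcases a1 with a1 | a1 | a1 <;> rcases a2 with a2 | a2 | a2 <;>
        first
        | (exfalso; omega)
        | simp [Int.add_emod, Int.sub_emod, Int.mul_emod, a1, a2]
    obtain ⟨m, hm⟩ : ∃ m, i * i + i * j + j * j - 1 = 3 * m := Int.dvd_of_emod_eq_zero h1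
    rw [hm, show i * i + i * j + j * j = 3 * m + 1 by omega, Int.mul_ediv_cancel_left _ (by norm_num),
      add_mul, zpow_add₀ hq0 (K * m), zpow_add₀ hq0 (3 * m), zpow_one]
    ring

lemma ker_summable {q : ℂ} {K L M u w : ℤ} (m : ℤ → ℤ → ℤ → ℂ) :
    Summable (latTerm q K (fun i j l => m i j l * ker q L M (i + u) j (l + w))) := by
  refine latTerm_summable_of_bound (|L| + |M| + |u|) fun i j l _ h => ?_
  have h1 := ker_ne_zero (right_ne_zero_of_mul h)
  grind

/-- Termwise form of the Bailey step. -/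
lemma bailey_step_Icc {q : ℂ} (hq0 : q ≠ 0) (hq : ‖q‖ < 1) {x y α β u v w : ℤ}
    (hx : β - 2 * α + x = -(u + v + w)) (hy : α - 2 * β + y = u + v + w)
    (hk : ∀ r s, ker q r s u v w ≠ 0 → α ≤ r ∧ β ≤ s) (L M : ℤ) :
    ∑ r ∈ Finset.Icc 0 L, ∑ s ∈ Finset.Icc 0 M,
      q ^ (r * r - r * s + s * s + x * r + y * s) * iq q (L - r) * iq q (M - s) *
        ker q (r + α) (s + β) u v w =
      q ^ (α * α - α * β + β * β - α * x - β * y - (u * v + u * w + v * w)) *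
        ker q (L + α) (M + β) u v w := by
  set N := |L + α| + |M + β| + |u| + |v| + |w| + |α| + |β| with hN
  have h := bailey_step hq0 hq (L + α) (M + β) u v w N (by grind)
  have key : ∑ r ∈ Finset.Icc 0 L, ∑ s ∈ Finset.Icc 0 M,
      q ^ (r * r - r * s + s * s + x * r + y * s) * iq q (L - r) * iq q (M - s) *
        ker q (r + α) (s + β) u v w =
      ∑ r ∈ Finset.Icc α (L + α), ∑ s ∈ Finset.Icc β (M + β),
        q ^ (α * α - α * β + β * β - α * x - β * y) *
        (q ^ (r * r - r * s + s * s - (u + v + w) * (r - s)) * iq q (L + α - r) *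
          iq q (M + β - s) * ker q r s u v w) := by
    refine Finset.sum_bij' (fun r _ => r + α) (fun r _ => r - α) (by simp) (by simp)
      (by simp) (by simp) fun r _ => ?_
    refine Finset.sum_bij' (fun s _ => s + β) (fun s _ => s - β) (by simp) (by simp)
      (by simp) (by simp) fun s _ => ?_
    rw [show L + α - (r + α) = L - r by ring, show M + β - (s + β) = M - s by ring,
      show r * r - r * s + s * s + x * r + y * s = (α * α - α * β + β * β - α * x - β * y) +
        ((r + α) * (r + α) - (r + α) * (s + β) + (s + β) * (s + β) -
        (u + v + w) * (r + α - (s + β))) by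
        linear_combination (r + α) * hx + (s + β) * hy, zpow_add₀ hq0]
    ring
  rw [key, sub_eq_add_neg (α * α - α * β + β * β - α * x - β * y), zpow_add₀ hq0, mul_assoc, ← h,
    Finset.mul_sum]
  simp only [← Finset.mul_sum]
  congr 1
  have i1 : Finset.Icc α (L + α) ⊆ Finset.Icc (-N) N := fun z hz => by
    simp only [Finset.mem_Icc] at hz ⊢; grind
  have i2 : Finset.Icc β (M + β) ⊆ Finset.Icc (-N) N := fun z hz => by
    simp only [Finset.mem_Icc] at hz ⊢; grind
  have z : ∀ r s, (r ∉ Finset.Icc α (L + α) ∨ s ∉ Finset.Icc β (M + β)) →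
      q ^ (r * r - r * s + s * s - (u + v + w) * (r - s)) * iq q (L + α - r) *
          iq q (M + β - s) * ker q r s u v w = 0 := by
    intro r s hrs
    by_contra h0
    have k1 := hk r s (right_ne_zero_of_mul h0)
    have k2 := iq_nonneg_of_ne_zero (right_ne_zero_of_mul (left_ne_zero_of_mul h0))
    have k3 := iq_nonneg_of_ne_zero (right_ne_zero_of_mul (left_ne_zero_of_mul
      (left_ne_zero_of_mul h0)))
    simp only [Finset.mem_Icc] at hrs
    omega
  rw [Finset.sum_subset i1 fun r _ hr => Finset.sum_eq_zero fun s _ => z r s (.inl hr)]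
  exact Finset.sum_congr rfl fun r _ => Finset.sum_subset i2 fun s _ hs => z r s (.inr hs)

lemma stepA_latSum (q : ℂ) (x y K L M : ℤ) (f : ℤ → ℤ → ℤ → ℤ → ℤ → ℂ)
    (hf : ∀ r s, Summable (latTerm q K (f r s))) :
    stepA q x y (fun r s => latSum q K (f r s)) L M =
      latSum q K (fun i j l => ∑ r ∈ Finset.Icc 0 L, ∑ s ∈ Finset.Icc 0 M,
        q ^ (r * r - r * s + s * s + x * r + y * s) * iq q (L - r) * iq q (M - s) * f r s i j l) := by
  have h : latTerm q K (fun i j l => ∑ r ∈ Finset.Icc 0 L, ∑ s ∈ Finset.Icc 0 M,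
      q ^ (r * r - r * s + s * s + x * r + y * s) * iq q (L - r) * iq q (M - s) * f r s i j l) =
      fun p => ∑ r ∈ Finset.Icc 0 L, ∑ s ∈ Finset.Icc 0 M,
        q ^ (r * r - r * s + s * s + x * r + y * s) * iq q (L - r) * iq q (M - s) *
          latTerm q K (f r s) p := by
    funext p
    simp only [latTerm, Finset.mul_sum]
    refine Finset.sum_congr rfl fun r _ => Finset.sum_congr rfl fun s _ => ?_
    ring
  rw [latSum, h, Summable.tsum_finsetSum fun r _ => summable_sum fun s _ => (hf r s).mul_left _,
    stepA]
  refine Finset.sum_congr rfl fun r _ => ?_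
  rw [Summable.tsum_finsetSum fun s _ => (hf r s).mul_left _]
  refine Finset.sum_congr rfl fun s _ => ?_
  rw [tsum_mul_left, latSum]

/-- The innermost sequence of the chain. -/
def chainInit (q : ℂ) (y r s : ℤ) : ℂ := q ^ (2 * r * s) * iq q r * iq q s * iq q (r + s + y)

/-- The weighted lattice sum of a monomial times a shifted kernel. -/
def kerSum (q : ℂ) (K A B L M u w : ℤ) : ℂ :=
  latSum q K (fun i j l => q ^ (A * i + B * l) * ker q L M (i + u) j (l + w))

lemma stepA_kerSum {q : ℂ} (hq0 : q ≠ 0) (hq : ‖q‖ < 1) {x y K A B α β u w : ℤ}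
    (hx : β - 2 * α + x = -(u + w)) (hy : α - 2 * β + y = u + w)
    (hk : ∀ r s i j l, i + j + l = 0 → i ≠ j → j ≠ l → i ≠ l →
      ker q r s (i + u) j (l + w) ≠ 0 → α ≤ r ∧ β ≤ s) (L M : ℤ) :
    stepA q x y (fun r s => kerSum q K A B (r + α) (s + β) u w) L M =
      q ^ (α * α - α * β + β * β - α * x - β * y - u * w + 1) *
        kerSum q (K + 3) (A + u) (B + w) (L + α) (M + β) u w := by
  unfold kerSum
  rw [stepA_latSum _ _ _ _ _ _ _ fun r s => ker_summable _, zpow_add₀ hq0, zpow_one, mul_assoc,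
    ← latSum_pow_mul hq0, ← latSum_const_mul]
  refine latSum_congr fun i j l hs h1 h2 h3 => ?_
  have h := bailey_step_Icc hq0 hq (x := x) (y := y) (α := α) (β := β) (u := i + u) (v := j)
    (w := l + w) (by linear_combination hx + hs) (by linear_combination hy - hs)
    (fun r s h => hk r s i j l hs h1 h2 h3 h) L M
  have hl : l = -i - j := by omega
  have e : q ^ (α * α - α * β + β * β - α * x - β * y - u * w) *
      (q ^ (i * i + i * j + j * j) * (q ^ ((A + u) * i + (B + w) * l) *
        ker q (L + α) (M + β) (i + u) j (l + w))) = q ^ (A * i + B * l) *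
      (q ^ (α * α - α * β + β * β - α * x - β * y -
        ((i + u) * j + (i + u) * (l + w) + j * (l + w))) *
        ker q (L + α) (M + β) (i + u) j (l + w)) := by
    rw [← mul_assoc, ← mul_assoc, ← mul_assoc, ← zpow_add₀ hq0, ← zpow_add₀ hq0, ← zpow_add₀ hq0]
    congr 2
    subst hl
    ring
  rw [e, ← h, Finset.mul_sum]
  refine Finset.sum_congr rfl fun r _ => ?_
  rw [Finset.mul_sum]
  refine Finset.sum_congr rfl fun s _ => ?_
  ring

lemma chainInit_eq {q : ℂ} (hq0 : q ≠ 0) (hq : ‖q‖ < 1) {r s : ℤ} (hr : 0 ≤ r) (hs : 0 ≤ s) :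
    chainInit q 1 r s = q ^ 2 * kerSum q 2 (-1) 1 (r + 1) (s + 1) 0 0 := by
  have h := baseSum_eq_baseVal hq0 hq (r + 1 + (s + 1)).toNat (r + 1) (s + 1) (by omega) (by omega)
    (by omega)
  have h1 : kerSum q 2 (-1) 1 (r + 1) (s + 1) 0 0 =
      qfac q (r + 1 + (s + 1)) * baseSum q (r + 1) (s + 1) := by
    rw [kerSum, baseSum, ← latSum_const_mul]
    congr 1
    funext i j l
    rw [ker, slots, slot, slot, slot, show -1 * i + 1 * l = l - i by ring]
    simp only [add_zero]
    ring
  have h2 := qfac_mul_iq hq (n := r + 1 + (s + 1)) (by omega)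
  rw [h1, h, baseVal, chainInit, show r + 1 + (s + 1) - 1 = r + s + 1 by ring,
    show -2 + 2 * (r + 1 - 1) * (s + 1 - 1) = -2 + 2 * r * s by ring, zpow_add₀ hq0,
    zpow_neg, zpow_ofNat, add_sub_cancel_right, add_sub_cancel_right]
  field_simp
  linear_combination (-(iq q r * iq q s * iq q (r + s + 1))) * h2

lemma chain_diag {q : ℂ} (hq0 : q ≠ 0) (hq : ‖q‖ < 1) (k : ℕ) :
    ∀ r s : ℤ, 0 ≤ r → 0 ≤ s → chain q k 0 0 (chainInit q 1) r s =
      q ^ 2 * kerSum q (3 * k + 2) (-1) 1 (r + 1) (s + 1) 0 0 := by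
  induction k with
  | zero => intro r s hr hs; simpa [chain] using chainInit_eq hq0 hq hr hs
  | succ k ih =>
    intro L M _ _
    rw [chain]
    simp only [if_true]
    rw [stepA_congr ih, stepA_mul, stepA_kerSum hq0 hq (by norm_num) (by norm_num)]
    · rw [show (3 : ℤ) * k + 2 + 3 = 3 * ↑(k + 1) + 2 by push_cast; ring]
      norm_num
    · intro r s i j l h _ _ _ hk
      have := ker_ne_zero hk
      omega

lemma kerSum_shift {q : ℂ} (hq0 : q ≠ 0) (hq : ‖q‖ < 1) (K : ℤ) {r s : ℤ} (hrs : 0 ≤ r + s + 1) :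
    kerSum q K (-1) 1 (r + 1) (s + 1) 0 0 = kerSum q K (-1) 1 r (s + 1) (-1) 0 := by
  unfold kerSum
  refine latSum_eq_of_alt_eq (ker_summable _) (ker_summable _) fun i j l hs _ _ _ => ?_
  have e0 : qfac q (r + 1 + (s + 1)) = (1 - q ^ (r + 1) * q ^ (s + 1)) * qfac q (r + (s + 1)) := by
    rw [show r + 1 + (s + 1) = r + (s + 1) + 1 by ring, qfac_succ (by omega), ← zpow_add₀ hq0,
      show r + (s + 1) + 1 = r + 1 + (s + 1) by ring]
    ring
  have e1 : ∀ m, iq q (r - m) = (1 - q ^ (r + 1) * (q ^ m)⁻¹) * iq q (r + 1 - m) := fun m => by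
    rw [show r - m = r + 1 - m - 1 by ring, iq_sub_one hq, zpow_sub₀ hq0, div_eq_mul_inv]
  have e2 : ∀ m, iq q (s + 1 + (m + -1)) = (1 - q ^ (s + 1) * q ^ m) * iq q (s + 1 + m) :=
    fun m => by
    rw [show s + 1 + (m + -1) = s + 1 + m - 1 by ring, iq_sub_one hq, zpow_add₀ hq0]
  have e3 : ∀ m, iq q (r - (m + -1)) = iq q (r + 1 - m) := fun m => by congr 1; ring
  have e4 : ∀ m n : ℤ, q ^ (-1 * m + 1 * n) = q ^ n / q ^ m := fun m n => by
    rw [← zpow_sub₀ hq0]; congr 1; ring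
  have hl : q ^ l = (q ^ i * q ^ j)⁻¹ := by
    rw [← zpow_add₀ hq0, ← zpow_neg]; congr 1; omega
  have hi := zpow_ne_zero i hq0
  have hj := zpow_ne_zero j hq0
  simp only [alt, ker, add_zero, e0, e2, e3, e4]
  simp only [e1]
  rw [hl]
  generalize iq q (r + 1 - i) = A1, iq q (r + 1 - j) = A2, iq q (r + 1 - l) = A3,
    iq q (s + 1 + i) = B1, iq q (s + 1 + j) = B2, iq q (s + 1 + l) = B3,
    qfac q (r + (s + 1)) = Q, q ^ (r + 1) = X, q ^ (s + 1) = Y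
  generalize q ^ i = a, q ^ j = b at *
  field_simp
  ring

lemma chain_left {q : ℂ} (hq0 : q ≠ 0) (hq : ‖q‖ < 1) (a : ℕ) :
    ∀ (k : ℕ), a ≤ k → ∀ r s : ℤ, 0 ≤ r → 0 ≤ s → chain q k a 0 (chainInit q 1) r s =
      q ^ (a + 2) * kerSum q (3 * k + 2) (-1 - a) 1 r (s + 1) (-1) 0 := by
  induction a with
  | zero =>
    intro k _ r s hr hs
    rw [chain_diag hq0 hq k r s hr hs, kerSum_shift hq0 hq _ (by omega)]
    simp
  | succ a ih =>
    intro k hk L M _ _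
    obtain ⟨k, rfl⟩ : ∃ k', k = k' + 1 := ⟨k - 1, by omega⟩
    rw [chain]
    simp only [if_true, Nat.add_sub_cancel]
    rw [stepA_congr (ih k (by omega)), stepA_mul]
    have h := stepA_kerSum hq0 hq (x := 0) (y := 1) (K := 3 * k + 2) (A := -1 - a) (B := 1)
      (α := 0) (β := 1) (u := -1) (w := 0) (by norm_num) (by norm_num)
      (fun r s i j l h _ _ _ hk => by have := ker_ne_zero hk; omega) L M
    simp only [add_zero] at h
    rw [if_neg (by omega), h, show (3 : ℤ) * k + 2 + 3 = 3 * ↑(k + 1) + 2 by push_cast; ring,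
      show (-1 : ℤ) - a + -1 = -1 - ↑(a + 1) by push_cast; ring]
    norm_num
    ring

lemma ker_swap23 (q : ℂ) (L M u v w : ℤ) : ker q L M u w v = ker q L M u v w := by
  rw [ker, ker]; ring

lemma ker_sub_pow_mul {q : ℂ} (hq0 : q ≠ 0) (hq : ‖q‖ < 1) {r s i j l : ℤ}
    (hrs : 0 ≤ r + s) (hjl : q ^ j ≠ q ^ l) :
    (1 - q ^ (s + i)) * ker q r (s + 1) (i + -1) j l =
      q ^ j / (q ^ j - q ^ l) * ker q r s (i + -1) (j + 1) l +
        q ^ l / (q ^ l - q ^ j) * ker q r s (i + -1) j (l + 1) := by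
  have e0 : qfac q (r + (s + 1)) = qfac q (r + s) * (1 - q ^ r * q ^ (s + 1)) := by
    rw [← add_assoc, qfac_succ hrs, ← zpow_add₀ hq0, ← add_assoc]
  have e1 : ∀ m : ℤ, iq q (r - (m + 1)) = (1 - q ^ r * (q ^ m)⁻¹) * iq q (r - m) := fun m => by
    rw [show r - (m + 1) = r - m - 1 by ring, iq_sub_one hq, zpow_sub₀ hq0, div_eq_mul_inv]
  have e2 : ∀ m : ℤ, iq q (s + m) = (1 - q ^ (s + 1) * q ^ m) * iq q (s + 1 + m) := fun m => by
    rw [show s + m = s + 1 + m - 1 by ring, iq_sub_one hq, zpow_add₀ hq0]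
  have e3 : iq q (s + (i + -1)) = (1 - q ^ (s + i)) * iq q (s + 1 + (i + -1)) := by
    rw [show s + (i + -1) = s + i - 1 by ring, iq_sub_one hq]
    congr 2
    ring
  have e4 : ∀ m : ℤ, iq q (s + (m + 1)) = iq q (s + 1 + m) := fun m => by congr 1; ring
  have hj := zpow_ne_zero j hq0
  have hl := zpow_ne_zero l hq0
  have h1 : q ^ j - q ^ l ≠ 0 := sub_ne_zero.mpr hjl
  have h2 : q ^ l - q ^ j ≠ 0 := sub_ne_zero.mpr hjl.symm
  simp only [ker, e0, e1, e4, e3]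
  rw [e2 j, e2 l, ← neg_sub (q ^ j) (q ^ l)]
  generalize iq q (s + 1 + (i + -1)) = B1, iq q (s + 1 + j) = B2, iq q (s + 1 + l) = B3,
    iq q (r - j) = A2, iq q (r - l) = A3, iq q (r - (i + -1)) = A1, qfac q (r + s) = Q,
    q ^ r = X, q ^ (s + 1) = Y, q ^ (s + i) = Z
  generalize q ^ j = b, q ^ l = c at *
  field_simp
  ring

lemma stepA_sub_kerSum {q : ℂ} (hq0 : q ≠ 0) (hq : ‖q‖ < 1) (K A L M : ℤ) :
    stepA q 0 0 (fun r s => kerSum q K A 1 r (s + 1) (-1) 0) L M -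
      q * kerSum q (K + 3) A 1 L (M + 1) (-1) 0 =
      q ^ 2 * kerSum q (K + 3) (A - 1) 2 L M (-1) 1 := by
  set P : ℤ → ℤ → ℤ → ℂ := fun i j l => q ^ l / (q ^ l - q ^ j) *
    q ^ (i * i + i * j + j * j + 1 + (A - 1) * i + j + l) * ker q L M (i + -1) j (l + 1) with hP
  set H : ℤ → ℤ → ℤ → ℂ := fun i j l => q ^ (i * i + i * j + j * j + 1 + (A - 1) * i + 2 * l) *
    ker q L M (i + -1) j (l + 1) with hH
  set D : ℤ → ℤ → ℤ → ℂ := fun i j l => q ^ l / (q ^ l - q ^ j) *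
    q ^ (i * i + i * j + j * j + 1 + (A - 1) * i + 2 * l) * ker q L M (i + -1) j (l + 1) with hD
  have sP : Summable (latTerm q K P) := ker_summable _
  have sD : Summable (latTerm q K D) := ker_summable _
  have hne : ∀ j l : ℤ, j ≠ l → q ^ j ≠ q ^ l := fun j l h e => by
    refine one_sub_zpow_ne_zero hq0 hq (sub_ne_zero.mpr h) ?_
    rw [zpow_sub₀ hq0, e, div_self (zpow_ne_zero l hq0), sub_self]
  have key : latSum q K H = latSum q K (fun i j l => P i l j + D i j l) := by
    rw [latSum_add (summable_swap23 sP) sD, latSum_swap23 q K P, neg_add_eq_sub, sub_eq_add_neg,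
      ← neg_one_mul, ← latSum_const_mul, ← latSum_add sD (latTerm_summable_const_mul _ sP)]
    refine latSum_congr fun i j l _ _ hjl _ => ?_
    have h1 : q ^ l - q ^ j ≠ 0 := sub_ne_zero.mpr (hne j l hjl).symm
    simp only [hP, hD, hH]
    rw [show i * i + i * j + j * j + 1 + (A - 1) * i + j + l =
      (i * i + i * j + j * j + 1 + (A - 1) * i) + j + l by ring, zpow_add₀ hq0 _ (2 * l),
      zpow_add₀ hq0 _ l, zpow_add₀ hq0 _ j, two_mul, zpow_add₀ hq0 l l]
    field_simp
    ring
  have hR : q ^ 2 * kerSum q (K + 3) (A - 1) 2 L M (-1) 1 = latSum q K H := by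
    rw [kerSum, sq, mul_assoc, ← latSum_pow_mul hq0, ← latSum_const_mul]
    congr 1
    funext i j l
    rw [hH, ← mul_assoc, ← mul_assoc, ← zpow_one_add₀ hq0, ← zpow_add₀ hq0]
    congr 2
    ring
  rw [hR, key]
  unfold kerSum
  rw [stepA_latSum _ _ _ _ _ _ _ fun r s => ker_summable _, ← latSum_pow_mul hq0, sub_eq_iff_eq_add,
    ← latSum_add (latTerm_summable_add (summable_swap23 sP) sD)
      ((ker_summable (fun i j l => q ^ (i * i + i * j + j * j) * q ^ (A * i + 1 * l))).congr
        fun p => by simp only [latTerm]; ring)]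
  refine latSum_congr fun i j l hs _ hjl _ => ?_
  have b0 := bailey_step_Icc hq0 hq (x := 0) (y := 1) (α := 0) (β := 1) (u := i + -1) (v := j)
    (w := l) (by linear_combination hs) (by linear_combination -hs)
    (fun r s h => by have := ker_ne_zero h; omega) L M
  have b1 := bailey_step_Icc hq0 hq (x := 0) (y := 0) (α := 0) (β := 0) (u := i + -1) (v := j + 1)
    (w := l) (by linear_combination hs) (by linear_combination -hs)
    (fun r s h => by have := ker_ne_zero h; omega) L M
  have b2 := bailey_step_Icc hq0 hq (x := 0) (y := 0) (α := 0) (β := 0) (u := i + -1) (v := j)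
    (w := l + 1) (by linear_combination hs) (by linear_combination -hs)
    (fun r s h => by have := ker_ne_zero h; omega) L M
  simp only [add_zero] at b0 b1 b2 ⊢
  have hl : l = -i - j := by omega
  have c0 : q ^ (i * i + i * j + j * j) * (q ^ (A * i + 1 * l) * ker q L (M + 1) (i + -1) j l) =
      q ^ (A * i + 1 * l) * (q ^ i * (q ^ (0 * 0 - 0 * 1 + 1 * 1 - 0 * 0 - 1 * 1 -
        ((i + -1) * j + (i + -1) * l + j * l)) * ker q L (M + 1) (i + -1) j l)) := by
    simp only [← mul_assoc, ← zpow_add₀ hq0]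
    congr 2
    subst hl
    ring
  have c1 : P i l j = q ^ (A * i + 1 * l) * (q ^ j / (q ^ j - q ^ l) *
      (q ^ (0 * 0 - 0 * 0 + 0 * 0 - 0 * 0 - 0 * 0 - ((i + -1) * (j + 1) + (i + -1) * l +
        (j + 1) * l)) * ker q L M (i + -1) (j + 1) l)) := by
    have e : q ^ (i * i + i * l + l * l + 1 + (A - 1) * i + l + j) = q ^ (A * i + 1 * l) *
        q ^ (0 * 0 - 0 * 0 + 0 * 0 - 0 * 0 - 0 * 0 - ((i + -1) * (j + 1) + (i + -1) * l +
          (j + 1) * l)) := by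
      rw [← zpow_add₀ hq0]
      congr 1
      subst hl
      ring
    simp only [hP]
    rw [e, ker_swap23]
    ring
  have c2 : D i j l = q ^ (A * i + 1 * l) * (q ^ l / (q ^ l - q ^ j) *
      (q ^ (0 * 0 - 0 * 0 + 0 * 0 - 0 * 0 - 0 * 0 - ((i + -1) * j + (i + -1) * (l + 1) +
        j * (l + 1))) * ker q L M (i + -1) j (l + 1))) := by
    have e : q ^ (i * i + i * j + j * j + 1 + (A - 1) * i + 2 * l) = q ^ (A * i + 1 * l) *
        q ^ (0 * 0 - 0 * 0 + 0 * 0 - 0 * 0 - 0 * 0 - ((i + -1) * j + (i + -1) * (l + 1) +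
          j * (l + 1))) := by
      rw [← zpow_add₀ hq0]
      congr 1
      subst hl
      ring
    simp only [hD]
    rw [e]
    ring
  rw [c0, c1, c2, ← b0, ← b1, ← b2]
  simp only [Finset.mul_sum, ← Finset.sum_add_distrib]
  refine Finset.sum_congr rfl fun r hr => Finset.sum_congr rfl fun s hs' => ?_
  have h := ker_sub_pow_mul hq0 hq (r := r) (s := s) (i := i)
    (add_nonneg (Finset.mem_Icc.1 hr).1 (Finset.mem_Icc.1 hs').1) (hne j l hjl)
  rw [zpow_add₀ hq0 s i] at h
  simp only [zero_mul, one_mul, add_zero]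
  rw [zpow_add₀ hq0 _ s]
  generalize ker q r (s + 1) (i + -1) j l = T at *
  linear_combination (q ^ (A * i + l) * q ^ (r * r - r * s + s * s) * iq q (L - r) *
    iq q (M - s)) * h

lemma chain_sub_chain {q : ℂ} (hq0 : q ≠ 0) (hq : ‖q‖ < 1) (b : ℕ) :
    ∀ (k a : ℕ), b ≤ a → a < k → ∀ r s : ℤ, 0 ≤ r → 0 ≤ s →
      chain q k (a + 1) (b + 1) (chainInit q 1) r s - q * chain q k a b (chainInit q 1) r s =
      q ^ (a + b + 4) * kerSum q (3 * k + 2) (-2 - a) (b + 2) r s (-1) 1 := by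
  induction b with
  | zero =>
    intro k a _ hk L M hL hM
    rw [chain_left hq0 hq a k hk.le L M hL hM]
    obtain ⟨k, rfl⟩ : ∃ k', k = k' + 1 := ⟨k - 1, by omega⟩
    rw [chain]
    simp only [Nat.add_sub_cancel, Nat.add_eq_zero_iff, one_ne_zero, and_false, if_false]
    rw [stepA_congr (chain_left hq0 hq a k (by omega)), stepA_mul]
    have h := stepA_sub_kerSum hq0 hq (3 * k + 2) (-1 - a) L M
    rw [show (3 : ℤ) * ↑(k + 1) + 2 = 3 * k + 2 + 3 by push_cast; ring,
      show (-2 : ℤ) - a = -1 - a - 1 by ring]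
    norm_num
    linear_combination q ^ (a + 2) * h
  | succ b ih =>
    intro k a hab hk L M _ _
    obtain ⟨k, rfl⟩ : ∃ k', k = k' + 1 := ⟨k - 1, by omega⟩
    obtain ⟨a, rfl⟩ : ∃ a', a = a' + 1 := ⟨a - 1, by omega⟩
    rw [chain, chain]
    simp only [Nat.add_sub_cancel, Nat.add_eq_zero_iff, one_ne_zero, and_false, if_false]
    rw [← stepA_sub_mul, stepA_congr (ih k a (by omega) (by omega)), stepA_mul]
    have h := stepA_kerSum hq0 hq (x := 0) (y := 0) (K := 3 * k + 2) (A := -2 - a) (B := b + 2)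
      (α := 0) (β := 0) (u := -1) (w := 1) (by norm_num) (by norm_num)
      (fun r s i j l h _ _ _ hk => by have := ker_ne_zero hk; omega) L M
    simp only [add_zero] at h
    rw [h, show (3 : ℤ) * k + 2 + 3 = 3 * ↑(k + 1) + 2 by push_cast; ring,
      show (-2 : ℤ) - a + -1 = -2 - ↑(a + 1) by push_cast; ring,
      show (b : ℤ) + 2 + 1 = ↑(b + 1) + 2 by push_cast; ring]
    norm_num
    norm_cast
    ring

lemma chain_diag_sub {q : ℂ} (hq0 : q ≠ 0) (hq : ‖q‖ < 1) (k : ℕ) :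
    ∀ r s : ℤ, 0 ≤ r → 0 ≤ s → chain q (k + 1) (k + 1) (k + 1) (chainInit q 1) r s -
      q * chain q (k + 1) k k (chainInit q 1) r s = chain q (k + 1) (k + 1) (k + 1)
        (chainInit q 0) r s := by
  induction k with
  | zero =>
    intro L M _ _
    simp only [chain, zero_add, one_ne_zero, if_true, if_false]
    simp only [stepA, Finset.mul_sum, ← Finset.sum_sub_distrib]
    refine Finset.sum_congr rfl fun r hr => Finset.sum_congr rfl fun s hs => ?_
    have h := iq_eq_succ hq (r + s)
    have e : q ^ (r + s + 1) = q * q ^ r * q ^ s := by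
      rw [zpow_add_one₀ hq0, zpow_add₀ hq0]; ring
    simp only [chainInit, zero_mul, one_mul, add_zero]
    rw [h, e, zpow_add₀ hq0 _ s, zpow_add₀ hq0 _ r]
    ring
  | succ k ih =>
    intro L M _ _
    have h : ∀ a b C, chain q (k + 1 + 1) a b C = stepA q (if a = 0 then 1 else 0)
        (if b = 0 then 1 else 0) (chain q (k + 1) (a - 1) (b - 1) C) := fun _ _ _ => rfl
    rw [h, h, h]
    simp only [Nat.add_sub_cancel, Nat.add_eq_zero_iff, one_ne_zero, and_false, if_false]
    rw [← stepA_sub_mul, stepA_congr ih]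

/-! ### Limits -/

lemma qPoch_tendsto (a : ℂ) {q : ℂ} (hq : ‖q‖ < 1) :
    Tendsto (fun n => qPoch a q n) atTop (𝓝 (qPochInf a q)) := by
  have h : Summable fun j : ℕ => ‖-(a * q ^ j)‖ := by
    simp only [norm_neg, norm_mul, norm_pow]
    exact (summable_geometric_of_lt_one (norm_nonneg _) hq).mul_left _
  have h1 := (multipliable_one_add_of_summable h).hasProd.tendsto_prod_nat
  simpa only [← sub_eq_add_neg, qPoch, qPochInf] using h1

lemma qPochInf_self_ne_zero {q : ℂ} (hq : ‖q‖ < 1) : qPochInf q q ≠ 0 := by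
  have h : Summable fun j : ℕ => ‖-(q * q ^ j)‖ := by
    simp only [norm_neg, norm_mul, norm_pow]
    exact (summable_geometric_of_lt_one (norm_nonneg _) hq).mul_left _
  have h1 := tprod_one_add_ne_zero_of_summable (f := fun j : ℕ => -(q * q ^ j)) (fun j => by
    rw [← sub_eq_add_neg, ← pow_succ']
    exact one_sub_pow_ne_zero hq (by omega)) h
  simpa only [← sub_eq_add_neg, qPochInf] using h1

lemma toNat_tendsto : Tendsto Int.toNat atTop atTop :=
  tendsto_atTop.2 fun n => (eventually_ge_atTop (n : ℤ)).mono fun m hm => by omega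

lemma qfac_tendsto {q : ℂ} (hq : ‖q‖ < 1) : Tendsto (qfac q) atTop (𝓝 (qPochInf q q)) :=
  (qPoch_tendsto q hq).comp toNat_tendsto

lemma iq_tendsto {q : ℂ} (hq : ‖q‖ < 1) : Tendsto (iq q) atTop (𝓝 (qPochInf q q)⁻¹) := by
  refine ((qfac_tendsto hq).inv₀ (qPochInf_self_ne_zero hq)).congr' ?_
  filter_upwards [eventually_ge_atTop 0] with n hn
  rw [iq, if_pos hn, qfac]

lemma qfac_bounded {q : ℂ} (hq : ‖q‖ < 1) : ∃ C : ℝ, 0 < C ∧ ∀ n, ‖qfac q n‖ ≤ C := by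
  obtain ⟨C, hC⟩ := (qPoch_tendsto q hq).norm.bddAbove_range
  exact ⟨max C 1, by positivity, fun n => le_max_of_le_left (hC ⟨n.toNat, rfl⟩)⟩

lemma iq_bounded {q : ℂ} (hq : ‖q‖ < 1) : ∃ C : ℝ, 0 < C ∧ ∀ n, ‖iq q n‖ ≤ C := by
  obtain ⟨C, hC⟩ := ((qPoch_tendsto q hq).inv₀ (qPochInf_self_ne_zero hq)).norm.bddAbove_range
  refine ⟨max C 1, by positivity, fun n => ?_⟩
  rw [iq]
  split_ifs
  · exact le_max_of_le_left (hC ⟨n.toNat, rfl⟩)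
  · simp

lemma natCast_add_tendsto (c : ℤ) : Tendsto (fun N : ℕ => (N : ℤ) + c) atTop atTop :=
  tendsto_atTop_add_const_right _ _ tendsto_natCast_atTop_atTop

/-! ### Summability -/

lemma summable_pow_natAbs {x : ℝ} (h0 : 0 ≤ x) (h1 : x < 1) : Summable fun n : ℤ => x ^ n.natAbs := by
  have := summable_geometric_of_lt_one h0 h1
  exact summable_int_iff_summable_nat_and_neg.2 ⟨by simpa using this, by simpa using this⟩

lemma zpow_le_of_exponent_le {x : ℝ} (h0 : 0 < x) (h1 : x < 1) {m n : ℤ} (h : m ≤ n) :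
    x ^ n ≤ x ^ m := by
  exact zpow_le_zpow_right_of_le_one₀ h0 h1.le h

lemma summable_zpow_of_le {x : ℝ} (h0 : 0 < x) (h1 : x < 1) (D : ℤ) {E : ℤ × ℤ → ℤ}
    (hE : ∀ p, |p.1| + |p.2| - D ≤ E p) : Summable fun p => x ^ E p := by
  have h := ((summable_pow_natAbs h0.le h1).mul_of_nonneg (summable_pow_natAbs h0.le h1)
    (fun _ => by positivity) (fun _ => by positivity)).mul_right (x ^ (-D))
  refine h.of_nonneg_of_le (fun p => by positivity) fun p => ?_
  refine (zpow_le_of_exponent_le h0 h1 (hE p)).trans (le_of_eq ?_)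
  rw [← zpow_natCast, ← zpow_natCast, ← zpow_add₀ h0.ne', ← zpow_add₀ h0.ne']
  congr 1
  simp only [Int.natCast_natAbs]
  ring

lemma sq_sub_mul_abs_le (c i : ℤ) : -(c * c) ≤ i * i - 2 * c * |i| := by
  nlinarith [sq_nonneg (|i| - c), abs_mul_abs_self i]

/-- The lattice sums of monomials converge absolutely. -/
lemma latTerm_zpow_summable {q : ℂ} (hq0 : q ≠ 0) (hq : ‖q‖ < 1) {K : ℤ} (hK : 1 ≤ K) (A B : ℤ) :
    Summable fun p => ‖latTerm q K (fun i _ l => q ^ (A * i + B * l)) p‖ := by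
  have h0 : 0 < ‖q‖ := norm_pos_iff.2 hq0
  set c : ℤ := |A| + |B| + 1 with hc
  have hA := abs_nonneg A
  have hB := abs_nonneg B
  refine (summable_zpow_of_le h0 hq (18 * (c * c) + K)
    (E := fun p => K * ((p.1 * p.1 + p.1 * p.2 + p.2 * p.2 - 1) / 3) +
      (A * p.1 + B * (-p.1 - p.2))) ?_).of_nonneg_of_le (fun p => norm_nonneg _) fun p => ?_
  · rintro ⟨i, j⟩
    simp only
    set d := (i * i + i * j + j * j - 1) / 3 with hd
    have h1 : i * i + i * j + j * j - 3 ≤ 3 * d := by omega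
    have h2 : 3 * d + 3 ≤ K * (3 * d + 3) := by nlinarith [sq_nonneg (i + j), sq_nonneg i, sq_nonneg j]
    have h3 := sq_sub_mul_abs_le (6 * c) i
    have h4 := sq_sub_mul_abs_le (6 * c) j
    have h5 : -((|A| + |B|) * |i|) ≤ (A - B) * i := by
      have := neg_abs_le ((A - B) * i)
      rw [abs_mul] at this
      nlinarith [abs_sub A B, abs_nonneg i]
    have h6 : -(|B| * |j|) ≤ -(B * j) := by
      have := le_abs_self (B * j)
      rw [abs_mul] at this
      linarith
    have := abs_nonneg i
    have := abs_nonneg j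
    have h7 : 0 ≤ |A| * |j| := by positivity
    have h8 : 0 ≤ (i + j) * (i + j) := mul_self_nonneg _
    have h9 : 0 ≤ |A| * |i| := by positivity
    have h10 : 0 ≤ |B| * |i| := by positivity
    have h11 : 0 ≤ |B| * |j| := by positivity
    have h12 : c * |i| = |A| * |i| + |B| * |i| + |i| := by rw [hc]; ring
    have h13 : c * |j| = |A| * |j| + |B| * |j| + |j| := by rw [hc]; ring
    have h14 := mul_self_nonneg c
    linarith
  · simp only [latTerm, wt, norm_mul, norm_zpow]
    rw [mul_assoc, ← zpow_add₀ h0.ne']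
    refine mul_le_of_le_one_left (by positivity) ?_
    rw [chi3]
    split_ifs <;> simp

/-- Passage to the limit in the weighted kernel sums. -/
lemma kerSum_tendsto {q : ℂ} (hq0 : q ≠ 0) (hq : ‖q‖ < 1) {K : ℤ} (hK : 1 ≤ K) (A B u w c : ℤ) :
    Tendsto (fun N : ℕ => kerSum q K A B N (N + c) u w) atTop
      (𝓝 (latSum q K (fun i _ l => q ^ (A * i + B * l)) * (qPochInf q q)⁻¹ ^ 5)) := by
  obtain ⟨C, hC, hiq⟩ := iq_bounded hq
  obtain ⟨C', hC', hqf⟩ := qfac_bounded hq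
  have hne := qPochInf_self_ne_zero hq
  rw [latSum, ← tsum_mul_right]
  refine tendsto_tsum_of_dominated_convergence
    (bound := fun p => ‖latTerm q K (fun i _ l => q ^ (A * i + B * l)) p‖ * (C' * C ^ 6))
    ((latTerm_zpow_summable hq0 hq hK A B).mul_right _) (fun p => ?_)
    (Eventually.of_forall fun N p => ?_)
  · simp only [latTerm, ← mul_assoc]
    refine Tendsto.const_mul _ ?_
    have h1 : ∀ i c : ℤ, Tendsto (fun N : ℕ => iq q (N + c + i)) atTop (𝓝 (qPochInf q q)⁻¹) :=
      fun i c => (iq_tendsto hq).comp (by simpa [add_assoc] using natCast_add_tendsto (c + i))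
    have h2 : ∀ i : ℤ, Tendsto (fun N : ℕ => iq q (N - i)) atTop (𝓝 (qPochInf q q)⁻¹) :=
      fun i => (iq_tendsto hq).comp (natCast_add_tendsto (-i))
    have h3 : Tendsto (fun N : ℕ => qfac q (N + (N + c))) atTop (𝓝 (qPochInf q q)) :=
      (qfac_tendsto hq).comp (tendsto_natCast_atTop_atTop.atTop_add_atTop
        (natCast_add_tendsto c))
    have h4 := ((h3.mul ((h2 (p.1 + u)).mul (h1 (p.1 + u) c))).mul
      ((h2 p.2).mul (h1 p.2 c))).mul ((h2 (-p.1 - p.2 + w)).mul (h1 (-p.1 - p.2 + w) c))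
    have h5 : (qPochInf q q)⁻¹ ^ 5 = qPochInf q q * ((qPochInf q q)⁻¹ * (qPochInf q q)⁻¹) *
        ((qPochInf q q)⁻¹ * (qPochInf q q)⁻¹) * ((qPochInf q q)⁻¹ * (qPochInf q q)⁻¹) := by
      field_simp
    rw [h5]
    exact h4
  · simp only [latTerm, ← mul_assoc]
    rw [norm_mul, mul_assoc]
    refine mul_le_mul_of_nonneg_left ?_ (norm_nonneg _)
    simp only [ker, norm_mul]
    have h : ∀ m n, ‖iq q m‖ * ‖iq q n‖ ≤ C * C := fun m n =>
      mul_le_mul (hiq m) (hiq n) (norm_nonneg _) hC.le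
    calc _ ≤ C' * (C * C) * (C * C) * (C * C) := by
          gcongr <;> first | exact hqf _ | exact hiq _
      _ = _ := by ring

/-! ### The multisums -/

lemma qBinom_eq (q : ℂ) (n m : ℤ) : qBinom q n m = qfac q n * iq q m * iq q (n - m) := by
  rw [qBinom, iq, iq, qfac]
  split_ifs with h1 h2 h3 h3 h3
  · field_simp
  all_goals first | omega | simp

lemma sum_Icc_succ_succ {α : Type*} [AddCommMonoid α] (f : ℕ → α) (m n : ℕ) :
    ∑ i ∈ Finset.Icc (m + 1) (n + 1), f i = ∑ i ∈ Finset.Icc m n, f (i + 1) := by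
  rw [← Finset.map_add_right_Icc, Finset.sum_map]
  rfl

lemma prod_Icc_one_succ {α : Type*} [CommMonoid α] (f : ℕ → α) (n : ℕ) :
    ∏ i ∈ Finset.Icc 1 (n + 1), f i = f 1 * ∏ i ∈ Finset.Icc 1 n, f (i + 1) := by
  induction n with
  | zero => simp
  | succ n ih =>
    rw [Finset.prod_Icc_succ_top (by omega), ih, Finset.prod_Icc_succ_top (by omega), mul_assoc]

lemma nth_cons_one {k : ℕ} (r : ℕ) (f : Fin k → ℕ) : nth (Fin.cons r f : Fin (k + 1) → ℕ) 1 = r := by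
  simp [nth]

lemma nth_cons_succ {k : ℕ} (r : ℕ) (f : Fin k → ℕ) {i : ℕ} (hi : 1 ≤ i) :
    nth (Fin.cons r f : Fin (k + 1) → ℕ) (i + 1) = nth f i := by
  obtain ⟨i, rfl⟩ : ∃ j, i = j + 1 := ⟨i - 1, by omega⟩
  rw [nth, nth]
  by_cases h : i + 1 ≤ k
  · rw [dif_pos (by omega), dif_pos (by omega)]
    exact Fin.cons_succ (α := fun _ => ℕ) r f ⟨i, by omega⟩
  · rw [dif_neg (by omega), dif_neg (by omega)]

lemma Mext_cons_one {k : ℕ} (r n : ℕ) (f : Fin (k + 1) → ℕ) (g : Fin k → ℕ) :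
    Mext (k := k + 2) (Fin.cons r f : Fin (k + 2) → ℕ) (Fin.cons n g : Fin (k + 1) → ℕ) 1 = n := by
  rw [Mext, if_neg (by omega)]
  exact nth_cons_one n g

lemma Mext_cons_succ {k : ℕ} (r n : ℕ) (f : Fin (k + 1) → ℕ) (g : Fin k → ℕ) {i : ℕ} (hi : 1 ≤ i) :
    Mext (k := k + 2) (Fin.cons r f : Fin (k + 2) → ℕ) (Fin.cons n g : Fin (k + 1) → ℕ) (i + 1) =
      Mext (k := k + 1) f g i := by
  rw [Mext, Mext]
  by_cases h : i = k + 1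
  · rw [if_pos (by omega), if_pos h, nth_cons_succ r f (by omega)]
  · rw [if_neg (by omega), if_neg h]
    exact nth_cons_succ n g hi

lemma sum_nth_cons {k : ℕ} (r a n : ℕ) (f : Fin k → ℕ) :
    ∑ i ∈ Finset.Icc (a + 1) (n + 1), nth (Fin.cons r f : Fin (k + 1) → ℕ) i =
      (if a = 0 then 1 else 0) * r + ∑ i ∈ Finset.Icc (a - 1 + 1) n, nth f i := by
  rw [sum_Icc_succ_succ]
  rcases a with _ | a
  · rw [← Finset.add_sum_Ioc_eq_sum_Icc (by omega), zero_add, nth_cons_one]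
    simp only [if_true, one_mul, zero_tsub, zero_add]
    congr 1
    rw [← Finset.Icc_add_one_left_eq_Ioc, zero_add]
    exact Finset.sum_congr rfl fun i hi => nth_cons_succ r f (Finset.mem_Icc.1 hi).1
  · simp only [Nat.add_sub_cancel, Nat.add_eq_zero_iff, one_ne_zero, and_false, if_false, zero_mul,
      zero_add]
    exact Finset.sum_congr rfl fun i hi => nth_cons_succ r f (by have := Finset.mem_Icc.1 hi; omega)

/-- The summand of the multisums. -/
def agTerm (q : ℂ) (k a b : ℕ) (p : (Fin k → ℕ) × (Fin (k - 1) → ℕ)) : ℂ :=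
  q ^ (nth p.1 k ^ 2 + (∑ i ∈ Finset.Icc (a + 1) k, nth p.1 i) +
        ∑ i ∈ Finset.Icc (b + 1) (k - 1), nth p.2 i) /
      qPoch q q (nth p.1 1) *
    ∏ i ∈ Finset.Icc 1 (k - 1),
      (q ^ (nth p.1 i ^ 2 + nth p.2 i ^ 2 - nth p.1 i * nth p.2 i) *
        qBinom q (nth p.1 i) (nth p.1 (i + 1)) *
        qBinom q ((nth p.1 i : ℤ) - (nth p.1 (i + 1) : ℤ) +
            (Mext p.1 p.2 (i + 1) : ℤ) + (if b = i then 1 else 0))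
          (nth p.2 i))

lemma agTerm_one (q : ℂ) (a b : ℕ) (p : (Fin 1 → ℕ) × (Fin 0 → ℕ)) :
    agTerm q 1 a b p =
      q ^ ((p.1 0 : ℤ) * p.1 0 + (if a = 0 then 1 else 0) * p.1 0) * iq q (p.1 0) := by
  have h : nth p.1 1 = p.1 0 := by simp [nth]
  have h2 : ∑ i ∈ Finset.Icc (a + 1) 1, nth p.1 i = (if a = 0 then 1 else 0) * p.1 0 := by
    rcases a with _ | a
    · simp [h]
    · simp
  have h3 : ∑ i ∈ Finset.Icc (b + 1) (1 - 1), nth p.2 i = 0 := by simp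
  rw [agTerm, h2, h3, h, iq, if_pos (Int.natCast_nonneg _)]
  simp only [Nat.sub_self, zero_lt_one, Finset.Icc_eq_empty_of_lt, Finset.prod_empty, mul_one,
    Int.toNat_natCast, add_zero, div_eq_mul_inv]
  congr 1
  rw [← zpow_natCast]
  congr 1
  split_ifs <;> push_cast <;> ring

/-- The factor gained when the multisum gets one more pair of summation variables. -/
def agStep (q : ℂ) (x y d r n l m : ℤ) : ℂ :=
  q ^ (r * r - r * n + n * n + x * r + y * n) * iq q (r - l) *
    (qfac q (r - l + m + d) * iq q n * iq q (r - l + m + d - n))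

lemma agTerm_cons {q : ℂ} (hq : ‖q‖ < 1) (k a b r n : ℕ) (f : Fin (k + 1) → ℕ) (g : Fin k → ℕ) :
    agTerm q (k + 2) a b ((Fin.cons r f : Fin (k + 2) → ℕ), (Fin.cons n g : Fin (k + 1) → ℕ)) =
      agTerm q (k + 1) (a - 1) (b - 1) (f, g) *
        agStep q (if a = 0 then 1 else 0) (if b = 0 then 1 else 0) (if b = 1 then 1 else 0) r n
          (nth f 1) (Mext (k := k + 1) f g 1) := by
  have e1 : ∏ i ∈ Finset.Icc 1 k,
      (q ^ (nth (Fin.cons r f : Fin (k + 2) → ℕ) (i + 1) ^ 2 +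
          nth (Fin.cons n g : Fin (k + 1) → ℕ) (i + 1) ^ 2 -
          nth (Fin.cons r f : Fin (k + 2) → ℕ) (i + 1) *
          nth (Fin.cons n g : Fin (k + 1) → ℕ) (i + 1)) *
        qBinom q (nth (Fin.cons r f : Fin (k + 2) → ℕ) (i + 1))
          (nth (Fin.cons r f : Fin (k + 2) → ℕ) (i + 1 + 1)) *
        qBinom q ((nth (Fin.cons r f : Fin (k + 2) → ℕ) (i + 1) : ℤ) -
            (nth (Fin.cons r f : Fin (k + 2) → ℕ) (i + 1 + 1) : ℤ) +
            (Mext (k := k + 2) (Fin.cons r f : Fin (k + 2) → ℕ) (Fin.cons n g : Fin (k + 1) → ℕ)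
              (i + 1 + 1) : ℤ) + (if b = i + 1 then 1 else 0))
          (nth (Fin.cons n g : Fin (k + 1) → ℕ) (i + 1))) =
      ∏ i ∈ Finset.Icc 1 k,
      (q ^ (nth f i ^ 2 + nth g i ^ 2 - nth f i * nth g i) *
        qBinom q (nth f i) (nth f (i + 1)) *
        qBinom q ((nth f i : ℤ) - (nth f (i + 1) : ℤ) +
            (Mext (k := k + 1) f g (i + 1) : ℤ) + (if b - 1 = i then 1 else 0)) (nth g i)) := by
    refine Finset.prod_congr rfl fun i hi => ?_
    have h1 := (Finset.mem_Icc.1 hi).1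
    rw [nth_cons_succ r f h1, nth_cons_succ n g h1, nth_cons_succ r f (by omega),
      Mext_cons_succ r n f g (by omega)]
    have : b = i + 1 ↔ b - 1 = i := by omega
    simp only [this]
  have e2 := sum_nth_cons r a (k + 1) f
  have e3 := sum_nth_cons n b k g
  have hsub : r * n ≤ r ^ 2 + n ^ 2 := by nlinarith [sq_nonneg ((r : ℤ) - n)]
  simp only [agTerm, show k + 2 - 1 = k + 1 from rfl, Nat.add_sub_cancel]
  rw [prod_Icc_one_succ, e1, e2, e3, nth_cons_succ r f (by omega), nth_cons_one,
    nth_cons_succ r f le_rfl, Mext_cons_succ r n f g le_rfl]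
  have e4 : nth (Fin.cons n g : Fin (k + 1) → ℕ) 1 = n := nth_cons_one n g
  rw [e4]
  simp only [qBinom_eq]
  generalize Finset.prod (M := ℂ) (Finset.Icc 1 k) _ = P
  rw [agStep]
  generalize hx : (if a = 0 then 1 else 0 : ℕ) = x
  generalize hy : (if b = 0 then 1 else 0 : ℕ) = y
  have hx' : (if a = 0 then 1 else 0 : ℤ) = x := by subst hx; split_ifs <;> rfl
  have hy' : (if b = 0 then 1 else 0 : ℤ) = y := by subst hy; split_ifs <;> rfl
  rw [hx', hy']
  have e5 : q ^ ((r : ℤ) * r - r * n + n * n + x * r + y * n) =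
      q ^ (x * r + y * n) * q ^ (r ^ 2 + n ^ 2 - r * n) := by
    rw [← pow_add, ← zpow_natCast]
    congr 1
    push_cast [Nat.cast_sub hsub]
    ring
  rw [e5]
  have h1 := qPoch_ne_zero hq r
  have h2 := qPoch_ne_zero hq (nth f 1)
  have h3 : qfac q r = qPoch q q r := by simp [qfac]
  have h4 : iq q (nth f 1) = (qPoch q q (nth f 1))⁻¹ := by simp [iq]
  rw [h3, h4]
  generalize qfac q _ = Q1, iq q (r - nth f 1 : ℤ) = Q2
  field_simp
  ring

lemma tsum_natCast {f : ℤ → ℂ} (h : ∀ n < 0, f n = 0) : ∑' n : ℕ, f n = ∑' n, f n := by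
  refine Nat.cast_injective.tsum_eq fun n hn => ?_
  have : 0 ≤ n := by
    by_contra h1
    exact hn (h n (by omega))
  exact ⟨n.toNat, by simp [this]⟩

lemma quad_ge (i j : ℤ) : |i| + |j| - 1 ≤ i * i - i * j + j * j := by
  have h1 := abs_mul_abs_self i
  have h2 := abs_mul_abs_self j
  nlinarith [sq_nonneg (|i| - 1), sq_nonneg (|j| - 1), sq_nonneg (i - j)]

lemma agStep_bound {q : ℂ} (hq0 : q ≠ 0) (hq : ‖q‖ < 1) : ∃ C : ℝ, 0 < C ∧
    ∀ (x y d l m : ℤ) (r n : ℕ), 0 ≤ x → 0 ≤ y →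
      ‖agStep q x y d r n l m‖ ≤ C * ‖q‖ ^ ((r : ℤ) * r - r * n + n * n) := by
  obtain ⟨C, hC, hiq⟩ := iq_bounded hq
  obtain ⟨C', hC', hqf⟩ := qfac_bounded hq
  refine ⟨C * (C' * C * C), by positivity, fun x y d l m r n hx hy => ?_⟩
  simp only [agStep, norm_mul, norm_zpow]
  have h : ‖q‖ ^ ((r : ℤ) * r - r * n + n * n + x * r + y * n) ≤
      ‖q‖ ^ ((r : ℤ) * r - r * n + n * n) := by
    refine zpow_le_of_exponent_le (norm_pos_iff.2 hq0) hq ?_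
    have : 0 ≤ x * r := by positivity
    have : 0 ≤ y * n := by positivity
    linarith
  rw [mul_comm _ (‖q‖ ^ _), mul_assoc]
  gcongr <;> first | exact hqf _ | exact hiq _

lemma summable_quad {q : ℂ} (hq0 : q ≠ 0) (hq : ‖q‖ < 1) :
    Summable fun z : ℕ × ℕ => ‖q‖ ^ ((z.1 : ℤ) * z.1 - z.1 * z.2 + z.2 * z.2) :=
  (summable_zpow_of_le (norm_pos_iff.2 hq0) hq 1
    (E := fun p => p.1 * p.1 - p.1 * p.2 + p.2 * p.2) fun p => quad_ge p.1 p.2).comp_injective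
    (i := Prod.map Nat.cast Nat.cast) (Nat.cast_injective.prodMap Nat.cast_injective)

lemma agStep_summable {q : ℂ} (hq0 : q ≠ 0) (hq : ‖q‖ < 1) {x y : ℤ} (hx : 0 ≤ x) (hy : 0 ≤ y)
    (d l m : ℤ) : Summable fun z : ℕ × ℕ => ‖agStep q x y d z.1 z.2 l m‖ := by
  obtain ⟨C, _, hb⟩ := agStep_bound hq0 hq
  exact ((summable_quad hq0 hq).mul_left C).of_nonneg_of_le (fun _ => norm_nonneg _)
    fun z => hb x y d l m z.1 z.2 hx hy

lemma summable_mul_of_bounded {ι : Type*} {f g : ι → ℂ} (hf : Summable fun i => ‖f i‖) {C : ℝ}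
    (hg : ∀ i, ‖g i‖ ≤ C) : Summable fun i => f i * g i := by
  refine Summable.of_norm_bounded (hf.mul_right C) fun i => ?_
  rw [norm_mul]
  exact mul_le_mul_of_nonneg_left (hg i) (norm_nonneg _)

lemma norm_iq_mul_le {q : ℂ} {C : ℝ} (hC : 0 < C) (h : ∀ n, ‖iq q n‖ ≤ C) (l m n : ℤ) :
    ‖iq q l * iq q m * iq q n‖ ≤ C * C * C := by
  simp only [norm_mul]
  gcongr <;> exact h _

lemma agStep_sum {q : ℂ} (hq0 : q ≠ 0) (hq : ‖q‖ < 1) {x y d l m : ℤ} (hx : 0 ≤ x) (hy : 0 ≤ y)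
    (hd : 0 ≤ d) (hl : 0 ≤ l) (hm : 0 ≤ m) (L : ℤ) {M : ℤ} (hM : 0 ≤ M) :
    ∑ r ∈ Finset.Icc 0 L, ∑ s ∈ Finset.Icc 0 M,
      q ^ (r * r - r * s + s * s + x * r + y * s) * iq q (L - r) * iq q (M - s) *
        (iq q (r - l) * iq q s * iq q (s + m - l + (y + d))) =
      ∑' z : ℕ × ℕ, agStep q x y d z.1 z.2 l m *
        (iq q (L - z.1) * iq q M * iq q (M + z.2 - z.1 + y)) := by
  obtain ⟨C, hC, hiq⟩ := iq_bounded hq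
  rw [Summable.tsum_prod (summable_mul_of_bounded (agStep_summable hq0 hq hx hy d l m)
    fun z => norm_iq_mul_le hC hiq _ _ _)]
  have hin : ∀ r : ℤ, ∑ s ∈ Finset.Icc 0 M,
      q ^ (r * r - r * s + s * s + x * r + y * s) * iq q (L - r) * iq q (M - s) *
        (iq q (r - l) * iq q s * iq q (s + m - l + (y + d))) =
      ∑' n : ℕ, agStep q x y d r n l m * (iq q (L - r) * iq q M * iq q (M + n - r + y)) := by
    intro r
    by_cases hr : r < l
    · simp [agStep, iq_of_neg (show r - l < 0 by omega)]
    have h := sum_eq_binomial_sum hq0 hq (l := r - y) (c := m - l + (y + d)) (M := M) (by omega) hM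
    rw [tsum_natCast (f := fun n => agStep q x y d r n l m *
      (iq q (L - r) * iq q M * iq q (M + n - r + y))) fun n hn => by simp [agStep, iq_of_neg hn],
      ← tsum_eq_Icc (f := fun s => q ^ (r * r - r * s + s * s + x * r + y * s) * iq q (L - r) *
        iq q (M - s) * (iq q (r - l) * iq q s * iq q (s + m - l + (y + d)))) 0 M fun n h => ?_]
    · trans q ^ (r * r + x * r) * iq q (L - r) * iq q (r - l) * ∑' s : ℤ,
        q ^ (s * s - (r - y) * s) * iq q (M - s) * iq q s * iq q (s + (m - l + (y + d)))
      · rw [← tsum_mul_left]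
        refine tsum_congr fun s => ?_
        rw [show r * r - r * s + s * s + x * r + y * s = r * r + x * r + (s * s - (r - y) * s) by ring,
          zpow_add₀ hq0, show s + m - l + (y + d) = s + (m - l + (y + d)) by ring]
        ring
      · rw [h, ← tsum_mul_left]
        refine tsum_congr fun n => ?_
        rw [agStep, show r * r - r * n + n * n + x * r + y * n =
          r * r + x * r + (n * n - (r - y) * n) by ring, zpow_add₀ hq0 (r * r + x * r),
          show r - y + (m - l + (y + d)) = r - l + m + d by ring,
          show M + n - (r - y) = M + n - r + y by ring]
        ring
    · have h1 := iq_nonneg_of_ne_zero (right_ne_zero_of_mul (left_ne_zero_of_mul h))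
      have h2 := iq_nonneg_of_ne_zero
        (right_ne_zero_of_mul (left_ne_zero_of_mul (right_ne_zero_of_mul h)))
      omega
  rw [tsum_natCast (f := fun r => ∑' n : ℕ, agStep q x y d r n l m *
    (iq q (L - r) * iq q M * iq q (M + n - r + y))) fun r hr => by
      simp [agStep, iq_of_neg (show r - l < 0 by omega)]]
  rw [tsum_eq_Icc 0 L fun r h => ?_]
  · exact Finset.sum_congr rfl fun r _ => hin r
  · by_contra h1
    rcases not_and_or.1 h1 with h1 | h1
    · exact h (by simp [agStep, iq_of_neg (show r - l < 0 by omega)])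
    · exact h (by simp [iq_of_neg (show L - r < 0 by omega)])

/-- Prepending one pair of summation variables. -/
def agEquiv (k : ℕ) : ((Fin (k + 1) → ℕ) × (Fin k → ℕ)) × (ℕ × ℕ) ≃
    (Fin (k + 2) → ℕ) × (Fin (k + 1) → ℕ) :=
  (Equiv.prodComm _ _).trans ((Equiv.prodProdProdComm ℕ ℕ _ _).trans
    (Equiv.prodCongr (Fin.consEquiv fun _ => ℕ) (Fin.consEquiv fun _ => ℕ)))

lemma agTerm_agEquiv {q : ℂ} (hq : ‖q‖ < 1) (k a b : ℕ)
    (z : ((Fin (k + 1) → ℕ) × (Fin k → ℕ)) × (ℕ × ℕ)) :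
    agTerm q (k + 2) a b (agEquiv k z) = agTerm q (k + 1) (a - 1) (b - 1) z.1 *
      agStep q (if a = 0 then 1 else 0) (if b = 0 then 1 else 0) (if b = 1 then 1 else 0) z.2.1
        z.2.2 (nth z.1.1 1) (Mext (k := k + 1) z.1.1 z.1.2 1) :=
  agTerm_cons hq k a b z.2.1 z.2.2 z.1.1 z.1.2

lemma agTerm_summable {q : ℂ} (hq0 : q ≠ 0) (hq : ‖q‖ < 1) (k : ℕ) :
    ∀ a b : ℕ, Summable fun p => ‖agTerm q (k + 1) a b p‖ := by
  induction k with
  | zero =>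
    intro a b
    obtain ⟨C, hC, hiq⟩ := iq_bounded hq
    let e : ℕ ≃ (Fin 1 → ℕ) × (Fin 0 → ℕ) :=
      ((Equiv.prodUnique (Fin 1 → ℕ) (Fin 0 → ℕ)).trans (Equiv.funUnique (Fin 1) ℕ)).symm
    rw [← e.summable_iff]
    refine ((summable_geometric_of_lt_one (norm_nonneg _) hq).mul_right C).of_nonneg_of_le
      (fun _ => norm_nonneg _) fun r => ?_
    have h : (e r).1 0 = r := rfl
    rw [Function.comp_apply, agTerm_one, h, norm_mul, norm_zpow, ← zpow_natCast ‖q‖ r]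
    refine mul_le_mul (zpow_le_of_exponent_le (norm_pos_iff.2 hq0) hq ?_) (hiq _) (norm_nonneg _)
      (by positivity)
    split_ifs <;> nlinarith [sq_nonneg ((r : ℤ) - 1), Int.natCast_nonneg r]
  | succ k ih =>
    intro a b
    obtain ⟨C, hC, hb⟩ := agStep_bound hq0 hq
    refine (agEquiv k).summable_iff.1 ?_
    refine ((ih (a - 1) (b - 1)).mul_of_nonneg ((summable_quad hq0 hq).mul_left C)
      (fun _ => norm_nonneg _) (fun _ => by positivity)).of_nonneg_of_le (fun _ => norm_nonneg _)
      fun z => ?_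
    simp only [Function.comp_apply]
    rw [agTerm_agEquiv hq, norm_mul]
    exact mul_le_mul_of_nonneg_left (hb _ _ _ _ _ _ _ (by split_ifs <;> simp)
      (by split_ifs <;> simp)) (norm_nonneg _)

lemma tsum_equiv_prod {α β γ : Type*} {f : γ → ℂ} (hf : Summable f) (e : α × β ≃ γ) :
    ∑' c, f c = ∑' a, ∑' b, f (e (a, b)) := by
  rw [← e.tsum_eq]
  exact (e.summable_iff.2 hf).tsum_prod

lemma chain_one_eq_tsum {q : ℂ} (hq0 : q ≠ 0) (hq : ‖q‖ < 1) (a b : ℕ) (L M : ℤ) :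
    chain q 1 a b (chainInit q (if b < 1 then 1 else 0)) L M =
      ∑' p : (Fin 1 → ℕ) × (Fin 0 → ℕ), agTerm q 1 a b p *
        (iq q (L - nth p.1 1) * iq q M * iq q (M + Mext (k := 1) p.1 p.2 1 - nth p.1 1 +
          if b = 0 then 1 else 0)) := by
  let e : ℕ ≃ (Fin 1 → ℕ) × (Fin 0 → ℕ) :=
    ((Equiv.prodUnique (Fin 1 → ℕ) (Fin 0 → ℕ)).trans (Equiv.funUnique (Fin 1) ℕ)).symm
  rw [← e.tsum_eq]
  have h : ∀ r, (e r).1 0 = r := fun _ => rfl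
  have h1 : ∀ r, nth (e r).1 1 = r := fun _ => by simp [nth, h]
  have h2 : ∀ r, Mext (k := 1) (e r).1 (e r).2 1 = 2 * r := fun _ => by simp [Mext, h1]
  simp only [agTerm_one, h, h1, h2, chain, stepA, chainInit, Nat.lt_one_iff, Nat.cast_mul, Nat.cast_ofNat]
  generalize (if a = 0 then 1 else 0 : ℤ) = x
  generalize (if b = 0 then 1 else 0 : ℤ) = y
  rw [tsum_natCast (f := fun r => q ^ (r * r + x * r) * iq q r * (iq q (L - r) * iq q M *
    iq q (M + 2 * r - r + y))) fun r hr => by simp [iq_of_neg hr]]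
  rw [tsum_eq_Icc 0 L fun r hr => ?_]
  · refine Finset.sum_congr rfl fun r _ => ?_
    have hv := q_vandermonde_limit hq0 hq M (r + y)
    rw [tsum_eq_Icc 0 M fun s hs => ?_] at hv
    · rw [show M + 2 * r - r + y = M + (r + y) by ring, mul_assoc (iq q (L - r)), ← hv]
      simp only [Finset.mul_sum]
      refine Finset.sum_congr rfl fun s _ => ?_
      have e1 : q ^ (r * r - r * s + s * s + x * r + y * s) * q ^ (2 * r * s) =
          q ^ (r * r + x * r) * q ^ (s * (s + (r + y))) := by
        rw [← zpow_add₀ hq0, ← zpow_add₀ hq0]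
        congr 1
        ring
      rw [show r + s + y = s + (r + y) by ring]
      linear_combination (iq q (L - r) * iq q (M - s) * iq q r * iq q s * iq q (s + (r + y))) * e1
    · have h1 := iq_nonneg_of_ne_zero (right_ne_zero_of_mul (left_ne_zero_of_mul hs))
      have h2 := iq_nonneg_of_ne_zero
        (right_ne_zero_of_mul (left_ne_zero_of_mul (left_ne_zero_of_mul hs)))
      omega
  · have h1 := iq_nonneg_of_ne_zero (right_ne_zero_of_mul (left_ne_zero_of_mul hr))
    have h2 := iq_nonneg_of_ne_zero
      (left_ne_zero_of_mul (left_ne_zero_of_mul (right_ne_zero_of_mul hr)))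
    omega

lemma chain_eq_tsum {q : ℂ} (hq0 : q ≠ 0) (hq : ‖q‖ < 1) (k : ℕ) :
    ∀ (a b : ℕ) (L M : ℤ), 0 ≤ M →
      chain q (k + 1) a b (chainInit q (if b < k + 1 then 1 else 0)) L M =
      ∑' p : (Fin (k + 1) → ℕ) × (Fin k → ℕ), agTerm q (k + 1) a b p *
        (iq q (L - nth p.1 1) * iq q M * iq q (M + Mext (k := k + 1) p.1 p.2 1 - nth p.1 1 +
          if b = 0 then 1 else 0)) := by
  induction k with
  | zero => intro a b L M _; exact chain_one_eq_tsum hq0 hq a b L M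
  | succ k ih =>
    intro a b L M hM
    obtain ⟨C, hC, hiq⟩ := iq_bounded hq
    have hb : b < k + 1 + 1 ↔ b - 1 < k + 1 := by omega
    have hsum := agTerm_summable hq0 hq k (a - 1) (b - 1)
    rw [chain]
    simp only [hb]
    rw [stepA_congr (fun r s _ hs => ih (a - 1) (b - 1) r s hs), stepA]
    simp only [← tsum_mul_left]
    have h1 : ∀ r s : ℤ, Summable fun p : (Fin (k + 1) → ℕ) × (Fin k → ℕ) =>
        agTerm q (k + 1) (a - 1) (b - 1) p *
          (iq q (r - nth p.1 1) * iq q s * iq q (s + Mext (k := k + 1) p.1 p.2 1 - nth p.1 1 +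
            if b - 1 = 0 then 1 else 0)) := fun r s =>
      summable_mul_of_bounded hsum fun p => norm_iq_mul_le hC hiq _ _ _
    have h2 := agTerm_summable hq0 hq (k + 1) a b
    have h3 : Summable fun p : (Fin (k + 2) → ℕ) × (Fin (k + 1) → ℕ) =>
        agTerm q (k + 2) a b p *
          (iq q (L - nth p.1 1) * iq q M * iq q (M + Mext (k := k + 2) p.1 p.2 1 - nth p.1 1 +
            if b = 0 then 1 else 0)) :=
      summable_mul_of_bounded h2 fun p => norm_iq_mul_le hC hiq _ _ _
    have e : ∀ z : ((Fin (k + 1) → ℕ) × (Fin k → ℕ)) × (ℕ × ℕ),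
        nth (agEquiv k z).1 1 = z.2.1 ∧
          Mext (k := k + 2) (agEquiv k z).1 (agEquiv k z).2 1 = z.2.2 := fun z =>
      ⟨nth_cons_one _ _, Mext_cons_one _ _ _ _⟩
    have hR : ∀ p z, agTerm q (k + 2) a b (agEquiv k (p, z)) *
        (iq q (L - nth (agEquiv k (p, z)).1 1) * iq q M *
          iq q (M + Mext (k := k + 2) (agEquiv k (p, z)).1 (agEquiv k (p, z)).2 1 -
            nth (agEquiv k (p, z)).1 1 + if b = 0 then 1 else 0)) =
        agTerm q (k + 1) (a - 1) (b - 1) p *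
          (agStep q (if a = 0 then 1 else 0) (if b = 0 then 1 else 0) (if b = 1 then 1 else 0) z.1
            z.2 (nth p.1 1) (Mext (k := k + 1) p.1 p.2 1) *
          (iq q (L - z.1) * iq q M * iq q (M + z.2 - z.1 + if b = 0 then 1 else 0))) := by
      intro p z
      rw [agTerm_agEquiv hq, (e _).1, (e _).2, mul_assoc]
    have hy : (if b - 1 = 0 then 1 else 0 : ℤ) =
        (if b = 0 then 1 else 0) + if b = 1 then 1 else 0 := by
      rcases b with _ | _ | b <;> simp
    have hx0 : (0 : ℤ) ≤ if a = 0 then 1 else 0 := by split_ifs <;> simp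
    have hy0 : (0 : ℤ) ≤ if b = 0 then 1 else 0 := by split_ifs <;> simp
    have hd0 : (0 : ℤ) ≤ if b = 1 then 1 else 0 := by split_ifs <;> simp
    refine Eq.trans ?_ (tsum_equiv_prod h3 (agEquiv k)).symm
    refine Eq.trans ?_ (tsum_congr fun p => ((tsum_congr (hR p)).trans tsum_mul_left).symm)
    refine Eq.trans ?_ (tsum_congr fun p => congrArg (agTerm q (k + 1) (a - 1) (b - 1) p * ·)
      (agStep_sum hq0 hq hx0 hy0 hd0 (Int.natCast_nonneg _) (Int.natCast_nonneg _) L hM))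
    simp only [Finset.mul_sum, hy] at h1 ⊢
    have h4 : ∀ r s, Summable fun p : (Fin (k + 1) → ℕ) × (Fin k → ℕ) =>
        agTerm q (k + 1) (a - 1) (b - 1) p * (q ^ (r * r - r * s + s * s +
          (if a = 0 then 1 else 0) * r + (if b = 0 then 1 else 0) * s) * iq q (L - r) *
          iq q (M - s) * (iq q (r - nth p.1 1) * iq q s *
            iq q (s + Mext (k := k + 1) p.1 p.2 1 - nth p.1 1 +
              ((if b = 0 then 1 else 0) + if b = 1 then 1 else 0)))) := fun r s =>
      ((h1 r s).mul_left _).congr fun p => mul_left_comm _ _ _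
    rw [Summable.tsum_finsetSum fun r _ => summable_sum fun s _ => h4 r s]
    refine Finset.sum_congr rfl fun r _ => ?_
    rw [Summable.tsum_finsetSum fun s _ => h4 r s]
    exact Finset.sum_congr rfl fun s _ => tsum_congr fun p => mul_left_comm _ _ _

lemma chain_tendsto {q : ℂ} (hq0 : q ≠ 0) (hq : ‖q‖ < 1) {k : ℕ} (hk : 1 ≤ k) (a b : ℕ) :
    Tendsto (fun N : ℕ => chain q k a b (chainInit q (if b < k then 1 else 0)) N N) atTop
      (𝓝 ((∑' p, agTerm q k a b p) * (qPochInf q q)⁻¹ ^ 3)) := by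
  obtain ⟨k, rfl⟩ := Nat.exists_eq_add_of_le' hk
  obtain ⟨C, hC, hiq⟩ := iq_bounded hq
  simp only [chain_eq_tsum hq0 hq k a b _ _ (Int.natCast_nonneg _)]
  rw [← tsum_mul_right]
  refine tendsto_tsum_of_dominated_convergence
    (bound := fun p => ‖agTerm q (k + 1) a b p‖ * (C * C * C))
    ((agTerm_summable hq0 hq k a b).mul_right _) (fun p => ?_)
    (Eventually.of_forall fun N p => ?_)
  · have h : ∀ c : ℤ, Tendsto (fun N : ℕ => iq q ((N : ℤ) + c)) atTop (𝓝 (qPochInf q q)⁻¹) :=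
      fun c => (iq_tendsto hq).comp (natCast_add_tendsto c)
    rw [show (qPochInf q q)⁻¹ ^ 3 = (qPochInf q q)⁻¹ * (qPochInf q q)⁻¹ * (qPochInf q q)⁻¹ by ring]
    refine Tendsto.const_mul _ (Tendsto.mul (Tendsto.mul (h (-nth p.1 1)) ?_) ?_)
    · simpa using h 0
    · convert h (Mext (k := k + 1) p.1 p.2 1 - nth p.1 1 + if b = 0 then 1 else 0) using 3
      ring
  · rw [norm_mul]
    exact mul_le_mul_of_nonneg_left (norm_iq_mul_le hC hiq _ _ _) (norm_nonneg _)

lemma chainInit_comm (q : ℂ) (y r s : ℤ) : chainInit q y r s = chainInit q y s r := by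
  rw [chainInit, chainInit, mul_right_comm 2 r s, add_comm r s]
  ring

/-- The lattice sum of the character. -/
def latChi (q : ℂ) (K : ℤ) (a b : ℕ) : ℂ :=
  q ^ (a + b + 2) * latSum q K fun i _ l => q ^ ((-1 - a) * i + (b + 1) * l)

lemma eq_of_mul_cube {q x y : ℂ} (hq : ‖q‖ < 1)
    (h : x * (qPochInf q q)⁻¹ ^ 3 = y * (qPochInf q q)⁻¹ ^ 5) : qPochInf q q ^ 2 * x = y := by
  have := qPochInf_self_ne_zero hq
  field_simp at h
  linear_combination h

lemma tsum_agTerm_comm {q : ℂ} (hq0 : q ≠ 0) (hq : ‖q‖ < 1) {k a b : ℕ} (ha : a < k) (hb : b < k) :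
    ∑' p, agTerm q k a b p = ∑' p, agTerm q k b a p := by
  have h := chain_tendsto hq0 hq (k := k) (by omega) a b
  have h' := chain_tendsto hq0 hq (k := k) (by omega) b a
  simp only [hb, ha, if_true] at h h'
  simp only [chain_swap (chainInit_comm q 1) k a b] at h
  exact mul_right_cancel₀ (pow_ne_zero 3 (inv_ne_zero (qPochInf_self_ne_zero hq)))
    (tendsto_nhds_unique h h')

lemma tsum_agTerm_right_zero {q : ℂ} (hq0 : q ≠ 0) (hq : ‖q‖ < 1) {k a : ℕ} (hk : 1 ≤ k)
    (ha : a ≤ k) : qPochInf q q ^ 2 * ∑' p, agTerm q k a 0 p = latChi q (3 * k + 2) a 0 := by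
  refine eq_of_mul_cube hq (tendsto_nhds_unique (chain_tendsto hq0 hq hk a 0) ?_)
  have h := (kerSum_tendsto hq0 hq (K := 3 * k + 2) (by omega) (-1 - a) 1 (-1) 0 1).const_mul
    (q ^ (a + 2))
  rw [← mul_assoc] at h
  simpa [latChi, show 0 < k by omega, chain_left hq0 hq a k ha] using h

lemma chain_sub_chain_tendsto {q : ℂ} (hq0 : q ≠ 0) (hq : ‖q‖ < 1) {k a b : ℕ} (ha : a < k)
    (hb : b ≤ a) : Tendsto (fun N : ℕ => chain q k (a + 1) (b + 1) (chainInit q 1) N N -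
      q * chain q k a b (chainInit q 1) N N) atTop
      (𝓝 (latChi q (3 * k + 2) (a + 1) (b + 1) * (qPochInf q q)⁻¹ ^ 5)) := by
  have h := (kerSum_tendsto hq0 hq (K := 3 * k + 2) (by omega) (-2 - a) (b + 2) (-1) 1 0).const_mul
    (q ^ (a + b + 4))
  have e : latChi q (3 * k + 2) (a + 1) (b + 1) = q ^ (a + b + 4) *
      latSum q (3 * k + 2) fun i _ l => q ^ ((-2 - a : ℤ) * i + (b + 2) * l) := by
    rw [latChi, show a + 1 + (b + 1) + 2 = a + b + 4 by ring]
    push_cast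
    simp only [show -1 - (a + 1 : ℤ) = -2 - a by ring, show (b + 1 + 1 : ℤ) = b + 2 by ring]
  rw [e, mul_assoc]
  simpa only [add_zero, ← chain_sub_chain hq0 hq b k a hb ha _ _ (Int.natCast_nonneg _)
    (Int.natCast_nonneg _)] using h

lemma tsum_agTerm_sub {q : ℂ} (hq0 : q ≠ 0) (hq : ‖q‖ < 1) {k a b : ℕ} (ha : a < k) (hb : b ≤ a)
    (hbk : b + 1 < k) :
    qPochInf q q ^ 2 * (∑' p, agTerm q k (a + 1) (b + 1) p - q * ∑' p, agTerm q k a b p) =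
      latChi q (3 * k + 2) (a + 1) (b + 1) := by
  have h1 := chain_tendsto hq0 hq (k := k) (by omega) (a + 1) (b + 1)
  have h2 := (chain_tendsto hq0 hq (k := k) (by omega) a b).const_mul q
  rw [if_pos (by omega)] at h1 h2
  refine eq_of_mul_cube hq ?_
  rw [sub_mul, mul_assoc]
  exact tendsto_nhds_unique (h1.sub h2) (chain_sub_chain_tendsto hq0 hq ha hb)

lemma tsum_agTerm_diag {q : ℂ} (hq0 : q ≠ 0) (hq : ‖q‖ < 1) {k : ℕ} (hk : 1 ≤ k) :
    qPochInf q q ^ 2 * ∑' p, agTerm q k k k p = latChi q (3 * k + 2) k k := by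
  obtain ⟨k, rfl⟩ := Nat.exists_eq_add_of_le' hk
  have h := chain_tendsto hq0 hq hk (k + 1) (k + 1)
  simp only [lt_irrefl, if_false,
    ← chain_diag_sub hq0 hq k _ _ (Int.natCast_nonneg _) (Int.natCast_nonneg _)] at h
  exact eq_of_mul_cube hq
    (tendsto_nhds_unique h (chain_sub_chain_tendsto hq0 hq (Nat.lt_succ_self k) le_rfl))

/-! ### The triple product -/

/-- The binomial coefficient `j (j - 1) / 2` of an integer. -/
def tri (j : ℤ) : ℤ := j * (j - 1) / 2

lemma two_mul_tri (j : ℤ) : 2 * tri j = j * (j - 1) :=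
  Int.mul_ediv_cancel' (by simpa using (Int.even_mul_pred_self j).two_dvd)

lemma tri_add_one (j : ℤ) : tri (j + 1) = tri j + j := by
  have h := two_mul_tri j
  have h' := two_mul_tri (j + 1)
  linarith

lemma tri_neg (j : ℤ) : tri (-j) = tri j + j := by
  have h := two_mul_tri j
  have h' := two_mul_tri (-j)
  linarith

/-- The general term of the theta series. -/
def jtp (z q : ℂ) (j : ℤ) : ℂ := (-z) ^ j * q ^ tri j

lemma jtp_add_one {z q : ℂ} (hz : z ≠ 0) (hq0 : q ≠ 0) (j : ℤ) :
    jtp z q (j + 1) = -z * q ^ j * jtp z q j := by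
  rw [jtp, jtp, tri_add_one, zpow_add₀ hq0, zpow_add_one₀ (neg_ne_zero.2 hz)]
  ring

lemma jtp_neg {z q : ℂ} (hq0 : q ≠ 0) (j : ℤ) : jtp z q (-j) = jtp (q / z) q j := by
  rw [jtp, jtp, tri_neg, zpow_add₀ hq0, zpow_neg, ← inv_zpow,
    show -(q / z) = (-z)⁻¹ * q by rw [inv_neg]; ring, mul_zpow]
  ring

lemma jtp_finite_succ {z q : ℂ} (hz : z ≠ 0) (hq0 : q ≠ 0) (hq : ‖q‖ < 1) (n m : ℤ) :
    (1 - q ^ (n + 1 + m)) * ∑' j : ℤ, jtp z q j * (iq q (n + 1 - j) * iq q (m + j)) =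
      (1 - z * q ^ n) * ∑' j : ℤ, jtp z q j * (iq q (n - j) * iq q (m + j)) := by
  have hs : Summable fun j : ℤ => jtp z q j * (iq q (n - j) * iq q (m + j)) :=
    summable_of_Icc (-m) n fun j h => by
      have h1 := iq_nonneg_of_ne_zero (right_ne_zero_of_mul (right_ne_zero_of_mul h))
      have h2 := iq_nonneg_of_ne_zero (left_ne_zero_of_mul (right_ne_zero_of_mul h))
      omega
  have h : ∀ j : ℤ, (1 - q ^ (n + 1 + m)) * (jtp z q j * (iq q (n + 1 - j) * iq q (m + j))) =
      jtp z q j * (iq q (n - j) * iq q (m + j)) -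
        z * q ^ n * (jtp z q (j + -1) * (iq q (n - (j + -1)) * iq q (m + (j + -1)))) := by
    intro j
    have h1 := iq_sub_one hq (n + 1 - j)
    have h2 := iq_sub_one hq (m + j)
    have h3 := jtp_add_one hz hq0 (j + -1)
    have h4 : q ^ (n + 1 + m) = q ^ (n + 1 - j) * q ^ (m + j) := by
      rw [← zpow_add₀ hq0]; ring_nf
    have h5 : q ^ n = q ^ (n + 1 - j) * q ^ (j + -1) := by
      rw [← zpow_add₀ hq0]; ring_nf
    rw [neg_add_cancel_right] at h3
    rw [show n - j = n + 1 - j - 1 by ring, show m + (j + -1) = m + j - 1 by ring,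
      show n - (j + -1) = n + 1 - j by ring, h1, h2, h3, h4, h5]
    ring
  rw [← tsum_mul_left, tsum_congr h, hs.tsum_sub ((summable_int_shift hs (-1)).mul_left _),
    tsum_mul_left, tsum_int_shift (fun j => jtp z q j * (iq q (n - j) * iq q (m + j)))]
  ring

/-- The finite form of the triple product identity. -/
lemma jtp_finite {z q : ℂ} (hz : z ≠ 0) (hq0 : q ≠ 0) (hq : ‖q‖ < 1) (n m : ℕ) :
    qfac q (n + m) * ∑' j : ℤ, jtp z q j * (iq q (n - j) * iq q (m + j)) =
      qPoch z q n * qPoch (q / z) q m := by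
  have step : ∀ (z : ℂ) (_ : z ≠ 0) (n m : ℕ),
      qfac q (n + m) * ∑' j : ℤ, jtp z q j * (iq q (n - j) * iq q (m + j)) =
        qPoch z q n * (qfac q m * ∑' j : ℤ, jtp z q j * (iq q (-j) * iq q (m + j))) := by
    intro z hz n m
    induction n with
    | zero => simp [qPoch]
    | succ n ih =>
      have h := jtp_finite_succ hz hq0 hq n m
      have e : ((n + 1 : ℕ) : ℤ) + m = n + m + 1 := by push_cast; ring
      rw [e, qfac_succ (by omega), qPoch, Finset.prod_range_succ, ← qPoch]
      rw [show (n : ℤ) + 1 + m = n + m + 1 by ring] at h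
      push_cast
      rw [mul_assoc, h]
      rw [zpow_natCast]
      linear_combination (1 - z * q ^ n) * ih
  have h0 : ∀ (m : ℕ), ∑' j : ℤ, jtp z q j * (iq q (-j) * iq q (m + j)) =
      ∑' j : ℤ, jtp (q / z) q j * (iq q (m - j) * iq q (0 + j)) := by
    intro m
    rw [← (Equiv.neg ℤ).tsum_eq]
    refine tsum_congr fun j => ?_
    rw [Equiv.neg_apply, jtp_neg hq0, neg_neg, zero_add, ← sub_eq_add_neg, mul_comm (iq q j)]
  have h1 := step (q / z) (div_ne_zero hq0 hz) m 0
  have h2 : ∑' j : ℤ, jtp (q / z) q j * (iq q (-j) * iq q ((0 : ℕ) + j)) = 1 := by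
    rw [tsum_eq_single 0 fun j hj => ?_]
    · simp [jtp, tri]
    · rcases lt_or_gt_of_ne hj with h | h
      · simp [iq_of_neg h]
      · simp [iq_of_neg (show -j < 0 by omega)]
  rw [step z hz n m, h0]
  rw [h2] at h1
  simp only [Nat.cast_zero, add_zero, qfac_zero, mul_one] at h1
  rw [h1]

lemma zpow_le_zpow_mul_abs {x y : ℝ} (hx : 0 < x) (hy : 0 < y) {c : ℕ} (h1 : x ^ c < y)
    (h2 : x ^ c < y⁻¹) (j : ℤ) : y ^ j ≤ x ^ (-(c * |j|)) := by
  have h2' : y ≤ (x ^ c)⁻¹ := by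
    rw [← inv_inv y]; exact inv_anti₀ (by positivity) h2.le
  have h1' : y⁻¹ ≤ (x ^ c)⁻¹ := inv_anti₀ (by positivity) h1.le
  obtain ⟨n, rfl | rfl⟩ := j.eq_nat_or_neg
  · rw [Nat.abs_cast, zpow_neg, zpow_natCast, zpow_mul, zpow_natCast, zpow_natCast, ← inv_pow]
    exact pow_le_pow_left₀ hy.le h2' n
  · rw [abs_neg, Nat.abs_cast, zpow_neg, zpow_neg, zpow_natCast, zpow_mul, zpow_natCast,
      zpow_natCast, ← inv_pow, ← inv_pow]
    exact pow_le_pow_left₀ (by positivity) h1' n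

lemma jtp_summable {z q : ℂ} (hz : z ≠ 0) (hq0 : q ≠ 0) (hq : ‖q‖ < 1) :
    Summable fun j => ‖jtp z q j‖ := by
  have hx : 0 < ‖q‖ := norm_pos_iff.2 hq0
  have hy : 0 < ‖z‖ := norm_pos_iff.2 hz
  obtain ⟨c, hc⟩ := exists_pow_lt_of_lt_one (lt_min hy (inv_pos.2 hy)) hq
  have hc1 := hc.trans_le (min_le_left _ _)
  have hc2 := hc.trans_le (min_le_right _ _)
  refine ((summable_pow_natAbs hx.le hq).mul_right (‖q‖ ^ (-(c + 2 : ℤ) * (c + 2)))).of_nonneg_of_le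
    (fun _ => norm_nonneg _) fun j => ?_
  rw [jtp, norm_mul, norm_zpow, norm_zpow, norm_neg, ← zpow_natCast, ← zpow_add₀ hx.ne',
    Int.natCast_natAbs]
  refine (mul_le_mul_of_nonneg_right (zpow_le_zpow_mul_abs hx hy hc1 hc2 j)
    (by positivity)).trans ?_
  rw [← zpow_add₀ hx.ne']
  refine zpow_le_of_exponent_le hx hq ?_
  have h1 := sq_sub_mul_abs_le (c + 2) j
  have h2 := two_mul_tri j
  have h3 := le_abs_self j
  nlinarith

/-- The Jacobi triple product identity. -/
lemma jacobi_triple_product {z q : ℂ} (hz : z ≠ 0) (hq0 : q ≠ 0) (hq : ‖q‖ < 1) :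
    ∑' j, jtp z q j = qPochInf q q * theta z q := by
  have hne := qPochInf_self_ne_zero hq
  obtain ⟨C, hC, hiq⟩ := iq_bounded hq
  have h1 : Tendsto (fun N : ℕ => qfac q (N + N) *
      ∑' j : ℤ, jtp z q j * (iq q (N - j) * iq q (N + j))) atTop
      (𝓝 (qPochInf q q * ∑' j : ℤ, jtp z q j * ((qPochInf q q)⁻¹ * (qPochInf q q)⁻¹))) := by
    refine Tendsto.mul ((qfac_tendsto hq).comp
      (tendsto_natCast_atTop_atTop.atTop_add_atTop tendsto_natCast_atTop_atTop)) ?_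
    refine tendsto_tsum_of_dominated_convergence (bound := fun j => ‖jtp z q j‖ * (C * C))
      ((jtp_summable hz hq0 hq).mul_right _) (fun j => ?_) (Eventually.of_forall fun N j => ?_)
    · exact (((iq_tendsto hq).comp (natCast_add_tendsto (-j))).mul
        ((iq_tendsto hq).comp (natCast_add_tendsto j))).const_mul _
    · rw [norm_mul, norm_mul]
      exact mul_le_mul_of_nonneg_left (mul_le_mul (hiq _) (hiq _) (norm_nonneg _) hC.le)
        (norm_nonneg _)
  have h2 : Tendsto (fun N : ℕ => qPoch z q N * qPoch (q / z) q N) atTop (𝓝 (theta z q)) :=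
    (qPoch_tendsto z hq).mul (qPoch_tendsto (q / z) hq)
  simp only [jtp_finite hz hq0 hq, tsum_mul_right] at h1
  have h := tendsto_nhds_unique h1 h2
  rw [← h]
  field_simp

/-! ### The product side -/

lemma norm_pow_lt_one {q : ℂ} (hq : ‖q‖ < 1) {n : ℕ} (hn : n ≠ 0) : ‖q ^ n‖ < 1 := by
  rw [norm_pow]
  exact pow_lt_one₀ (norm_nonneg _) hq hn

lemma qPochInf_one {q : ℂ} (hq : ‖q‖ < 1) : qPochInf 1 q = 0 := by
  refine tendsto_nhds_unique (qPoch_tendsto 1 hq) (tendsto_const_nhds.congr' ?_)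
  filter_upwards [eventually_ge_atTop 1] with n hn
  obtain ⟨n, rfl⟩ := Nat.exists_eq_add_of_le' hn
  simp [qPoch, Finset.prod_range_succ']

lemma qPochInf_trisect {q : ℂ} (hq : ‖q‖ < 1) :
    qPochInf q q = qPochInf (q ^ 3) (q ^ 3) * (qPochInf q (q ^ 3) * qPochInf (q ^ 2) (q ^ 3)) := by
  have h3 := norm_pow_lt_one hq three_ne_zero
  have h : ∀ n, qPoch q q (3 * n) =
      qPoch (q ^ 3) (q ^ 3) n * (qPoch q (q ^ 3) n * qPoch (q ^ 2) (q ^ 3) n) := by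
    intro n
    induction n with
    | zero => simp [qPoch]
    | succ n ih =>
      rw [qPoch] at ih ⊢
      rw [show 3 * (n + 1) = 3 * n + 1 + 1 + 1 by ring, Finset.prod_range_succ,
        Finset.prod_range_succ, Finset.prod_range_succ, ih]
      simp only [qPoch, Finset.prod_range_succ]
      ring
  have h1 := (qPoch_tendsto q hq).comp (tendsto_id.const_mul_atTop' (show 0 < 3 by norm_num))
  have h2 := (qPoch_tendsto (q ^ 3) h3).mul ((qPoch_tendsto q h3).mul (qPoch_tendsto (q ^ 2) h3))
  exact tendsto_nhds_unique (h1.congr h) h2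

lemma tri_add (i j : ℤ) : tri (i + j) = tri i + tri j + i * j := by
  have h := two_mul_tri i
  have h' := two_mul_tri j
  have h'' := two_mul_tri (i + j)
  linarith

lemma jtp_shift {z q : ℂ} (hz : z ≠ 0) (hq0 : q ≠ 0) (m j : ℤ) :
    jtp (z * q ^ (-m)) q (j + m) = (-z) ^ m * q ^ (tri m - m * m) * jtp z q j := by
  have e : q ^ (-m * (j + m)) * q ^ tri (j + m) = q ^ (tri m - m * m) * q ^ tri j := by
    rw [← zpow_add₀ hq0, ← zpow_add₀ hq0, tri_add]
    ring_nf
  rw [jtp, jtp, ← neg_mul, mul_zpow, ← zpow_mul, mul_assoc, e, zpow_add₀ (neg_ne_zero.2 hz)]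
  ring

lemma tsum_jtp_shift {z q : ℂ} (hz : z ≠ 0) (hq0 : q ≠ 0) (m : ℤ) :
    ∑' j, jtp (z * q ^ (-m)) q j = (-z) ^ m * q ^ (tri m - m * m) * ∑' j, jtp z q j := by
  rw [← tsum_int_shift _ m, ← tsum_mul_left]
  exact tsum_congr fun j => jtp_shift hz hq0 m j

/-- Pentagonal-type sums. -/
lemma tsum_jtp_cube {q : ℂ} (hq0 : q ≠ 0) (hq : ‖q‖ < 1) (m : ℤ) :
    ∑' j, jtp (q ^ (2 - 3 * m)) (q ^ 3) j =
        (-1) ^ m * q ^ (2 * m + 3 * (tri m - m * m)) * qPochInf q q ∧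
      ∑' j, jtp (q ^ (2 - (3 * m + 1))) (q ^ 3) j =
        (-1) ^ m * q ^ (m + 3 * (tri m - m * m)) * qPochInf q q ∧
      ∑' j, jtp (q ^ (2 - (3 * m + 2))) (q ^ 3) j = 0 := by
  have h3 := norm_pow_lt_one hq three_ne_zero
  have h30 : q ^ 3 ≠ 0 := pow_ne_zero _ hq0
  have key : ∀ e : ℕ, ∑' j, jtp (q ^ (e - 3 * m)) (q ^ 3) j =
      (-1) ^ m * q ^ (e * m + 3 * (tri m - m * m)) *
        (qPochInf (q ^ 3) (q ^ 3) * theta (q ^ e) (q ^ 3)) := by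
    intro e
    have h := tsum_jtp_shift (pow_ne_zero e hq0) h30 m
    rw [jacobi_triple_product (pow_ne_zero e hq0) h30 h3] at h
    have e1 : q ^ (e - 3 * m) = q ^ e * (q ^ 3) ^ (-m) := by
      rw [← zpow_natCast, ← zpow_natCast, ← zpow_mul, ← zpow_add₀ hq0]
      congr 1
      push_cast
      ring
    rw [e1, h, neg_eq_neg_one_mul, mul_zpow, zpow_add₀ hq0, zpow_mul, zpow_mul, zpow_natCast,
      show q ^ (3 : ℤ) = q ^ 3 from zpow_natCast q 3, mul_assoc ((-1) ^ m)]
  have hd : ∀ a b c : ℕ, a = b + c → q ^ a / q ^ b = q ^ c := by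
    rintro _ b c rfl
    rw [pow_add, mul_div_cancel_left₀ _ (pow_ne_zero _ hq0)]
  refine ⟨?_, ?_, ?_⟩
  · have h := key 2
    rw [theta, hd 3 2 1 rfl, mul_comm (qPochInf (q ^ 2) _), pow_one, ← qPochInf_trisect hq] at h
    exact_mod_cast h
  · have h := key 1
    rw [theta, hd 3 1 2 rfl, pow_one, ← qPochInf_trisect hq] at h
    rw [show (2 : ℤ) - (3 * m + 1) = (1 : ℕ) - 3 * m by push_cast; ring, h]
    simp
  · have h := key 0
    rw [theta, pow_zero, qPochInf_one h3, zero_mul, mul_zero, mul_zero] at h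
    rw [show (2 : ℤ) - (3 * m + 2) = (0 : ℕ) - 3 * m by push_cast; ring, h]

/-- Equivalence changing the summation variables of the triple theta series. -/
def thetaEquiv : (ℤ × ℤ) × ℤ ≃ (ℤ × ℤ) × ℤ where
  toFun p := ((p.1.1 - p.2, p.1.2 - p.2), p.2)
  invFun p := ((p.1.1 + p.2, p.1.2 + p.2), p.2)
  left_inv p := by simp
  right_inv p := by simp

lemma jtp_mul_jtp_mul_jtp {x y q : ℂ} (hx : x ≠ 0) (hy : y ≠ 0) (hq0 : q ≠ 0) (a b c : ℤ) :
    jtp x q (a - c) * jtp y q (b - c) * jtp (x * y) q c =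
      jtp x q a * jtp y q b * jtp (q ^ (2 - (a + b))) (q ^ 3) c := by
  have h2 := two_mul_tri
  have e : q ^ tri (a - c) * q ^ tri (b - c) * q ^ tri c =
      q ^ tri a * q ^ tri b * (q ^ ((2 - (a + b)) * c) * q ^ (3 * tri c)) := by
    simp only [← zpow_add₀ hq0]
    congr 1
    linarith [h2 a, h2 b, h2 c, h2 (a - c), h2 (b - c)]
  have hx' := neg_ne_zero.2 hx
  have hy' := neg_ne_zero.2 hy
  have e2 : (-(x * y)) ^ c = (-1) ^ c * ((-x) ^ c * (-y) ^ c) := by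
    rw [← mul_zpow, ← mul_zpow]
    ring_nf
  have e3 : (-q ^ (2 - (a + b))) ^ c = (-1) ^ c * q ^ ((2 - (a + b)) * c) := by
    rw [neg_eq_neg_one_mul, mul_zpow, zpow_mul]
  have e4 : (q ^ 3) ^ tri c = q ^ (3 * tri c) := by
    rw [zpow_mul]; rfl
  simp only [jtp]
  rw [e2, e3, e4, zpow_sub₀ hx', zpow_sub₀ hy']
  have := zpow_ne_zero c hx'
  have := zpow_ne_zero c hy'
  field_simp
  linear_combination e

/-- The inner sum of the triple theta series. -/
lemma jtp_mul_tsum_jtp {x y q : ℂ} (hq0 : q ≠ 0) (hq : ‖q‖ < 1) (a b : ℤ) :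
    jtp x q a * jtp y q b * ∑' c, jtp (q ^ (2 - (a + b))) (q ^ 3) c =
      qPochInf q q * (wt q 1 (1 - a) (a - b) * (x ^ a * y ^ b)) := by
  obtain ⟨h0, h1, h2⟩ := tsum_jtp_cube hq0 hq ((a + b) / 3)
  have ha := two_mul_tri a
  have hb := two_mul_tri b
  have hm := two_mul_tri ((a + b) / 3)
  set m := (a + b) / 3 with hm0
  have hab : a + b = 3 * m ∨ a + b = 3 * m + 1 ∨ a + b = 3 * m + 2 := by omega
  have hneg : ∀ t : ℂ, ∀ n : ℤ, (-t) ^ n = (-1) ^ n * t ^ n := fun t n => by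
    rw [neg_eq_neg_one_mul, mul_zpow]
  have hsg : ∀ e : ℤ, a + b = 3 * m + e → ((-1 : ℂ) ^ a * (-1) ^ b) * (-1) ^ m = (-1) ^ e := by
    intro e he
    rw [← zpow_add₀ (by norm_num), ← zpow_add₀ (by norm_num), he,
      show 3 * m + e + m = e + 2 * (2 * m) by ring, zpow_add₀ (by norm_num), zpow_mul]
    norm_num
  rw [jtp, jtp, wt, one_mul, hneg x, hneg y]
  rcases hab with h | h | h
  · have hd : ((1 - a) * (1 - a) + (1 - a) * (a - b) + (a - b) * (a - b) - 1) / 3 =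
        tri a + tri b + (2 * m + 3 * (tri m - m * m)) := by
      refine Int.ediv_eq_of_eq_mul_right three_ne_zero (mul_left_cancel₀ two_ne_zero ?_)
      linear_combination -3 * ha - 3 * hb - 9 * hm + (1 - (a + b) - 3 * m) * h
    have hs := hsg 0 (by omega)
    rw [h, h0, hd, zpow_add₀ hq0 (tri a + tri b), zpow_add₀ hq0 (tri a), chi3, if_pos (by omega)]
    rw [zpow_zero] at hs
    linear_combination (x ^ a * q ^ tri a * (y ^ b * q ^ tri b) *
      q ^ (2 * m + 3 * (tri m - m * m)) * qPochInf q q) * hs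
  · have hd : ((1 - a) * (1 - a) + (1 - a) * (a - b) + (a - b) * (a - b) - 1) / 3 =
        tri a + tri b + (m + 3 * (tri m - m * m)) := by
      refine Int.ediv_eq_of_eq_mul_right three_ne_zero (mul_left_cancel₀ two_ne_zero ?_)
      linear_combination -3 * ha - 3 * hb - 9 * hm - (a + b + 3 * m) * h
    have hs := hsg 1 (by omega)
    rw [h, h1, hd, zpow_add₀ hq0 (tri a + tri b), zpow_add₀ hq0 (tri a), chi3, if_neg (by omega),
      if_pos (by omega)]
    rw [zpow_one] at hs
    linear_combination (x ^ a * q ^ tri a * (y ^ b * q ^ tri b) *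
      q ^ (m + 3 * (tri m - m * m)) * qPochInf q q) * hs
  · rw [h, h2, chi3, if_neg (by omega), if_neg (by omega)]
    simp

/-- The Macdonald identity of type `A₂`. -/
lemma theta_product {x y q : ℂ} (hx : x ≠ 0) (hy : y ≠ 0) (hq0 : q ≠ 0) (hq : ‖q‖ < 1) :
    qPochInf q q ^ 2 * (theta x q * theta y q * theta (x * y) q) =
      ∑' p : ℤ × ℤ, wt q 1 (1 - p.1) (p.1 - p.2) * (x ^ p.1 * y ^ p.2) := by
  have hne := qPochInf_self_ne_zero hq
  have hxy := mul_ne_zero hx hy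
  have sx := jtp_summable hx hq0 hq
  have sy := jtp_summable hy hq0 hq
  have sz := jtp_summable hxy hq0 hq
  refine mul_left_cancel₀ hne ?_
  rw [← tsum_mul_left]
  have h := tsum_mul_tsum_of_summable_norm sx sy
  have h' := tsum_mul_tsum_of_summable_norm (sx.mul_norm sy) sz
  have s := summable_mul_of_summable_norm (sx.mul_norm sy) sz
  rw [← h, jacobi_triple_product hx hq0 hq, jacobi_triple_product hy hq0 hq,
    jacobi_triple_product hxy hq0 hq, tsum_equiv_prod s thetaEquiv] at h'
  trans qPochInf q q * theta x q * (qPochInf q q * theta y q) * (qPochInf q q * theta (x * y) q)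
  · ring
  rw [h']
  refine tsum_congr fun p => ?_
  rw [← jtp_mul_tsum_jtp hq0 hq, ← tsum_mul_left]
  exact tsum_congr fun c => jtp_mul_jtp_mul_jtp hx hy hq0 p.1 p.2 c

/-- Change of variables between the theta series and the lattice sum. -/
def latEquiv : ℤ × ℤ ≃ ℤ × ℤ where
  toFun p := (1 - p.1, p.1 - p.2)
  invFun p := (1 - p.1, 1 - p.1 - p.2)
  left_inv p := by simp
  right_inv p := by simp

lemma latChi_eq {q : ℂ} (hq0 : q ≠ 0) (hq : ‖q‖ < 1) {K : ℕ} (hK : K ≠ 0) (a b : ℕ) :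
    latChi q K a b = qPochInf q q ^ 2 * chiT q K a b := by
  have hne := qPochInf_self_ne_zero hq
  have h := theta_product (pow_ne_zero (a + 1) hq0) (pow_ne_zero (b + 1) hq0) (pow_ne_zero K hq0)
    (norm_pow_lt_one hq hK)
  rw [← pow_add, show a + 1 + (b + 1) = a + b + 2 by ring] at h
  rw [chiT, ← mul_assoc, mul_div_cancel₀ _ (pow_ne_zero 2 hne), h, latChi, latSum, ← tsum_mul_left,
    ← latEquiv.tsum_eq]
  refine tsum_congr fun p => ?_
  have e : q ^ (a + b + 2) * q ^ ((-1 - a : ℤ) * (1 - p.1) + (b + 1) * (-(1 - p.1) - (p.1 - p.2))) =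
      (q ^ (a + 1)) ^ p.1 * (q ^ (b + 1)) ^ p.2 := by
    simp only [← zpow_natCast, ← zpow_mul, ← zpow_add₀ hq0]
    congr 1
    push_cast
    ring
  have e1 : wt q K (1 - p.1) (p.1 - p.2) = wt (q ^ K) 1 (1 - p.1) (p.1 - p.2) := by
    rw [wt, wt, one_mul, zpow_mul, zpow_natCast]
  rw [← e, ← e1, latTerm]
  simp only [latEquiv, Equiv.coe_fn_mk]
  ring

lemma chiT_comm (q : ℂ) (K a b : ℕ) : chiT q K a b = chiT q K b a := by
  rw [chiT, chiT, add_comm a b]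
  ring

/-! ### The case `q = 0` -/

lemma qPoch_zero_zero (n : ℕ) : qPoch 0 0 n = 1 := by
  simp [qPoch]

lemma qPochInf_zero_left (q : ℂ) : qPochInf 0 q = 1 := by
  simp [qPochInf]

lemma chiT_zero {K : ℕ} (hK : K ≠ 0) (a b : ℕ) : chiT 0 K a b = 1 := by
  simp [chiT, theta, zero_pow hK, qPochInf_zero_left]

lemma qBinom_zero_left_zero {n : ℤ} (hn : 0 ≤ n) : qBinom 0 n 0 = 1 := by
  simp [qBinom, hn, qPoch_zero_zero]

lemma agTerm_zero (k a b : ℕ) (p : (Fin k → ℕ) × (Fin (k - 1) → ℕ)) :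
    agTerm 0 k a b p = if p = 0 then 1 else 0 := by
  split_ifs with hp
  · subst hp
    have h1 (n i : ℕ) : nth (0 : Fin n → ℕ) i = 0 := by simp [nth]
    have h2 (i : ℕ) : Mext (0 : Fin k → ℕ) (0 : Fin (k - 1) → ℕ) i = 0 := by simp [Mext, h1]
    have h3 (i : ℕ) : (0 : ℤ) ≤ if b = i then 1 else 0 := by split_ifs <;> simp
    simp [agTerm, h1, h2, h3, qPoch_zero_zero, qBinom_zero_left_zero]
  · rw [agTerm, mul_eq_zero, Finset.prod_eq_zero_iff]
    have key (i : ℕ) (hi : i ∈ Finset.Icc 1 (k - 1)) (h : nth p.1 i ≠ 0 ∨ nth p.2 i ≠ 0) :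
        (0 : ℂ) ^ (nth p.1 i ^ 2 + nth p.2 i ^ 2 - nth p.1 i * nth p.2 i) = 0 := by
      refine zero_pow (Nat.sub_ne_zero_of_lt ?_)
      rcases h with h | h
      · nlinarith [Nat.pos_of_ne_zero h, sq_nonneg ((nth p.1 i : ℤ) - nth p.2 i)]
      · nlinarith [Nat.pos_of_ne_zero h]
    have hp' : (∃ j, p.1 j ≠ 0) ∨ ∃ j, p.2 j ≠ 0 := by
      by_contra! h
      exact hp (Prod.ext (funext h.1) (funext h.2))
    rcases hp' with ⟨j, hj⟩ | ⟨j, hj⟩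
    · have hn : nth p.1 (j + 1) = p.1 j := by simp [nth]
      by_cases hjk : (j : ℕ) + 1 = k
      · left
        rw [zero_pow, zero_div]
        have : nth p.1 k ≠ 0 := fun h => hj (by rw [← hn, ← h]; exact congrArg _ hjk)
        positivity
      · right
        have hm : (j : ℕ) + 1 ∈ Finset.Icc 1 (k - 1) := by rw [Finset.mem_Icc]; omega
        exact ⟨_, hm, by rw [key _ hm (Or.inl (hn ▸ hj)), zero_mul, zero_mul]⟩
    · have hn : nth p.2 (j + 1) = p.2 j := by simp [nth]
      have hm : (j : ℕ) + 1 ∈ Finset.Icc 1 (k - 1) := by rw [Finset.mem_Icc]; omega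
      exact Or.inr ⟨_, hm, by rw [key _ hm (Or.inr (hn ▸ hj)), zero_mul, zero_mul]⟩

lemma tsum_agTerm_zero (k a b : ℕ) : ∑' p, agTerm 0 k a b p = 1 := by
  simp only [agTerm_zero, tsum_ite_eq]

/-! ### The identities in terms of `agTerm` -/

lemma tsum_agTerm_diag_eq_chiT {q : ℂ} (hq : ‖q‖ < 1) {k : ℕ} (hk : 1 ≤ k) :
    ∑' p, agTerm q k k k p = chiT q (3 * k + 2) k k := by
  rcases eq_or_ne q 0 with rfl | hq0
  · rw [tsum_agTerm_zero, chiT_zero (by omega)]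
  · refine mul_left_cancel₀ (pow_ne_zero 2 (qPochInf_self_ne_zero hq)) ?_
    rw [tsum_agTerm_diag hq0 hq hk, ← latChi_eq hq0 hq (by omega)]
    push_cast
    rfl

lemma tsum_agTerm_right_zero_eq_chiT {q : ℂ} (hq : ‖q‖ < 1) {k a : ℕ} (hk : 1 ≤ k) (ha : a ≤ k) :
    ∑' p, agTerm q k a 0 p = chiT q (3 * k + 2) a 0 := by
  rcases eq_or_ne q 0 with rfl | hq0
  · rw [tsum_agTerm_zero, chiT_zero (by omega)]
  · refine mul_left_cancel₀ (pow_ne_zero 2 (qPochInf_self_ne_zero hq)) ?_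
    rw [tsum_agTerm_right_zero hq0 hq hk ha, ← latChi_eq hq0 hq (by omega)]
    push_cast
    rfl

lemma tsum_agTerm_left_zero_eq_chiT {q : ℂ} (hq : ‖q‖ < 1) {k b : ℕ} (hb : b < k) :
    ∑' p, agTerm q k 0 b p = chiT q (3 * k + 2) 0 b := by
  rcases eq_or_ne q 0 with rfl | hq0
  · rw [tsum_agTerm_zero, chiT_zero (by omega)]
  · rw [tsum_agTerm_comm hq0 hq (by omega) hb, chiT_comm,
      tsum_agTerm_right_zero_eq_chiT hq (by omega) hb.le]

lemma tsum_agTerm_sub_eq_chiT {q : ℂ} (hq : ‖q‖ < 1) {k a b : ℕ} (ha : a < k) (hb : b + 1 < k) :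
    ∑' p, agTerm q k (a + 1) (b + 1) p - q * ∑' p, agTerm q k a b p =
      chiT q (3 * k + 2) (a + 1) (b + 1) := by
  rcases eq_or_ne q 0 with rfl | hq0
  · rw [tsum_agTerm_zero, chiT_zero (by omega), zero_mul, sub_zero]
  · have main {a b : ℕ} (ha : a < k) (hab : b ≤ a) (hb : b + 1 < k) :
        ∑' p, agTerm q k (a + 1) (b + 1) p - q * ∑' p, agTerm q k a b p =
          chiT q (3 * k + 2) (a + 1) (b + 1) := by
      refine mul_left_cancel₀ (pow_ne_zero 2 (qPochInf_self_ne_zero hq)) ?_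
      rw [tsum_agTerm_sub hq0 hq ha hab hb, ← latChi_eq hq0 hq (by omega)]
      push_cast
      rfl
    rcases le_total b a with hab | hab
    · exact main ha hab hb
    · rw [tsum_agTerm_comm hq0 hq (by omega : a + 1 < k) hb,
        tsum_agTerm_comm hq0 hq ha (by omega : b < k), chiT_comm]
      exact main (by omega) hab (by omega)

end

/-- The `A₂⁽¹⁾` Andrews–Gordon identities for modulus `K = 3k + 2`
(Theorem 7.2 of the paper), together with the simpler expression for
`χ̃_{k,k}^K(q)`. -/
theorem A2_andrews_gordon_II
    (k : ℕ) (hk : 1 ≤ k) (a b : ℕ) (ha : a ≤ k) (hb : b < k)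
    (q : ℂ) (hq : ‖q‖ < 1) :
    (chiT q (3 * k + 2) a b =
      (∑' p : (Fin k → ℕ) × (Fin (k - 1) → ℕ),
        q ^ (nth p.1 k ^ 2 + (∑ i ∈ Finset.Icc (a + 1) k, nth p.1 i) +
              ∑ i ∈ Finset.Icc (b + 1) (k - 1), nth p.2 i) /
            qPoch q q (nth p.1 1) *
          ∏ i ∈ Finset.Icc 1 (k - 1),
            (q ^ (nth p.1 i ^ 2 + nth p.2 i ^ 2 - nth p.1 i * nth p.2 i) *
              qBinom q (nth p.1 i) (nth p.1 (i + 1)) *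
              qBinom q ((nth p.1 i : ℤ) - (nth p.1 (i + 1) : ℤ) +
                  (Mext p.1 p.2 (i + 1) : ℤ) + (if b = i then 1 else 0))
                (nth p.2 i))) -
      (∑' p : (Fin k → ℕ) × (Fin (k - 1) → ℕ),
        (if a = 0 ∨ b = 0 then (0 : ℂ) else
          q ^ (1 + nth p.1 k ^ 2 + (∑ i ∈ Finset.Icc a k, nth p.1 i) +
                ∑ i ∈ Finset.Icc b (k - 1), nth p.2 i) /
              qPoch q q (nth p.1 1) *
            ∏ i ∈ Finset.Icc 1 (k - 1),
              (q ^ (nth p.1 i ^ 2 + nth p.2 i ^ 2 - nth p.1 i * nth p.2 i) *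
                qBinom q (nth p.1 i) (nth p.1 (i + 1)) *
                qBinom q ((nth p.1 i : ℤ) - (nth p.1 (i + 1) : ℤ) +
                    (Mext p.1 p.2 (i + 1) : ℤ) + (if b = i + 1 then 1 else 0))
                  (nth p.2 i))))) ∧
    chiT q (3 * k + 2) k k =
      ∑' p : (Fin k → ℕ) × (Fin (k - 1) → ℕ),
        q ^ (nth p.1 k ^ 2) / qPoch q q (nth p.1 1) *
          ∏ i ∈ Finset.Icc 1 (k - 1),
            (q ^ (nth p.1 i ^ 2 + nth p.2 i ^ 2 - nth p.1 i * nth p.2 i) *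
              qBinom q (nth p.1 i) (nth p.1 (i + 1)) *
              qBinom q ((nth p.1 i : ℤ) - (nth p.1 (i + 1) : ℤ) +
                  (Mext p.1 p.2 (i + 1) : ℤ))
                (nth p.2 i)) := by
  constructor
  · rcases a with _ | a
    · simp only [true_or, if_true, tsum_zero, sub_zero]
      exact (tsum_agTerm_left_zero_eq_chiT hq hb).symm
    rcases b with _ | b
    · simp only [or_true, if_true, tsum_zero, sub_zero]
      exact (tsum_agTerm_right_zero_eq_chiT hq hk ha).symm
    rw [← tsum_agTerm_sub_eq_chiT hq ha hb, ← tsum_mul_left]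
    congr 1
    refine tsum_congr fun p => ?_
    simp only [Nat.succ_ne_zero, or_self, if_false, agTerm, Nat.add_right_cancel_iff]
    ring
  · rw [← tsum_agTerm_diag_eq_chiT hq hk]
    refine tsum_congr fun p => ?_
    rw [agTerm, Finset.Icc_eq_empty (by omega : ¬ k + 1 ≤ k),
      Finset.Icc_eq_empty (by omega : ¬ k + 1 ≤ k - 1), Finset.sum_empty, Finset.sum_empty,
      add_zero, add_zero]
    congr 1
    refine Finset.prod_congr rfl fun i hi => ?_
    rw [if_neg (by rw [Finset.mem_Icc] at hi; omega), add_zero]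

end Stmt2
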